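/- Let q ∈ L²_loc(ℝ) be real-valued and periodic, and let h = −d²/dx² + q be the associated self-adjoint Schrödinger operator in L²(ℝ). If σ(h) = [e₀,∞) for some e₀ ∈ ℝ, then q(x) = e₀ for a.e. x ∈ ℝ. -/

import Mathlib

open MeasureTheory Filter Topology Complex

noncomputable section

/-- `ψ` (with derivative `ψd`) is a scalar solution of `-ψ'' + q ψ = z ψ`, in the integral
(locally absolutely continuous) sense. -/
def IsScalarSol (q : ℝ → ℝ) (z : ℂ) (ψ ψd : ℝ → ℂ) : Prop :=
  (∀ x : ℝ, HasDerivAt ψ (ψd x) x) ∧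
  (∀ x : ℝ, ψd x = ψd 0 + ∫ t in (0:ℝ)..x, (((q t : ℝ) : ℂ) - z) * ψ t)

/-- Absolute continuity is inherited along a Lipschitz-type domination of increments. -/
theorem AbsolutelyContinuousOnInterval.of_dist_le {X Y : Type*} [PseudoMetricSpace X]
    [PseudoMetricSpace Y] {F : ℝ → X} {G : ℝ → Y} {a b K : ℝ}
    (hG : AbsolutelyContinuousOnInterval G a b)
    (h : ∀ x ∈ Set.uIcc a b, ∀ y ∈ Set.uIcc a b, dist (F x) (F y) ≤ K * dist (G x) (G y)) :
    AbsolutelyContinuousOnInterval F a b := by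
  rw [absolutelyContinuousOnInterval_iff] at hG ⊢
  intro ε hε
  obtain ⟨δ, hδ, H⟩ := hG (ε / (|K| + 1)) (by positivity)
  refine ⟨δ, hδ, fun E hE hlt => ?_⟩
  have h1 := H E hE hlt
  have h2 : ∑ i ∈ Finset.range E.1, dist (F (E.2 i).1) (F (E.2 i).2)
      ≤ ∑ i ∈ Finset.range E.1, (|K| + 1) * dist (G (E.2 i).1) (G (E.2 i).2) := by
    refine Finset.sum_le_sum fun i hi => ?_
    have hm := hE.1 i hi
    refine (h _ hm.1 _ hm.2).trans ?_
    gcongr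
    linarith [le_abs_self K]
  rw [← Finset.mul_sum] at h2
  calc _ ≤ _ := h2
    _ < (|K| + 1) * (ε / (|K| + 1)) := by gcongr
    _ = ε := by field_simp

/-- `F` is absolutely continuous on `[a, b]` with integrable almost everywhere derivative `f`. -/
structure ACD {E : Type*} [NormedAddCommGroup E] [NormedSpace ℝ E] (F f : ℝ → E) (a b : ℝ) :
    Prop where
  ac : AbsolutelyContinuousOnInterval F a b
  deriv : ∀ᵐ x : ℝ, x ∈ Set.Ioo a b → HasDerivAt F (f x) x
  int : IntervalIntegrable f volume a b

theorem absolutelyContinuousOnInterval_integral {E : Type*} [NormedAddCommGroup E]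
    [NormedSpace ℝ E] {f : ℝ → E} {a b : ℝ}
    (hf : IntervalIntegrable f volume a b) :
    AbsolutelyContinuousOnInterval (fun x => ∫ t in a..x, f t) a b := by
  have h1 := hf.norm.absolutelyContinuousOnInterval_intervalIntegral (c := a) (by simp)
  refine h1.of_dist_le (K := 1) fun x hx y hy => ?_
  have ix : IntervalIntegrable f volume a x :=
    hf.mono_set (Set.uIcc_subset_uIcc_left hx)
  have iy : IntervalIntegrable f volume a y :=
    hf.mono_set (Set.uIcc_subset_uIcc_left hy)
  rw [one_mul, dist_eq_norm, dist_eq_norm, intervalIntegral.integral_interval_sub_left ix iy,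
    intervalIntegral.integral_interval_sub_left ix.norm iy.norm]
  exact intervalIntegral.norm_integral_le_abs_integral_norm

namespace ACD

variable {E : Type*} [NormedAddCommGroup E] [NormedSpace ℝ E] {F f G g : ℝ → E} {a b : ℝ}

theorem mono (h : ACD F f a b) {c d : ℝ} (hac : a ≤ c) (hcd : c ≤ d) (hdb : d ≤ b) :
    ACD F f c d := by
  have hs : Set.uIcc c d ⊆ Set.uIcc a b := by
    rw [Set.uIcc_of_le hcd, Set.uIcc_of_le (by linarith)]
    exact Set.Icc_subset_Icc hac hdb
  refine ⟨h.ac.mono hs, ?_, h.int.mono_set hs⟩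
  filter_upwards [h.deriv] with x hx hxm
  exact hx ⟨by linarith [hxm.1], by linarith [hxm.2]⟩

theorem continuousOn (h : ACD F f a b) (hab : a ≤ b) : ContinuousOn F (Set.Icc a b) := by
  simpa [Set.uIcc_of_le hab] using h.ac.continuousOn

theorem of_integral [CompleteSpace E] (hab : a ≤ b) (hf : IntervalIntegrable f volume a b)
    (h : ∀ x ∈ Set.Icc a b, F x = F a + ∫ t in a..x, f t) : ACD F f a b := by
  refine ⟨?_, ?_, hf⟩
  · refine (absolutelyContinuousOnInterval_integral hf).of_dist_le (K := 1) fun x hx y hy => ?_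
    rw [Set.uIcc_of_le hab] at hx hy
    rw [h x hx, h y hy]
    simp
  · filter_upwards [hf.ae_hasDerivAt_integral] with x hx hxm
    have hx1 := hx (by rw [Set.uIcc_of_le hab]; exact Set.Ioo_subset_Icc_self hxm) a
      (by simp)
    have := hx1.const_add (F a)
    refine this.congr_of_eventuallyEq ?_
    filter_upwards [Ioo_mem_nhds hxm.1 hxm.2] with y hy
    exact h y (Set.Ioo_subset_Icc_self hy)

theorem integral_eq [CompleteSpace E] (h : ACD F f a b) (hab : a ≤ b) :
    ∫ t in a..b, f t = F b - F a := by
  have hI : ACD (fun x => ∫ t in a..x, f t) f a b := of_integral hab h.int (by simp)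
  have hac := h.ac.sub hI.ac
  have h0 : ∀ᵐ x : ℝ, x ∈ Set.uIcc a b →
      HasDerivAt (F - fun x => ∫ t in a..x, f t) 0 x := by
    have ha : ∀ᵐ x : ℝ, x ≠ a := by simp [ae_iff]
    have hb : ∀ᵐ x : ℝ, x ≠ b := by simp [ae_iff]
    filter_upwards [h.deriv, hI.deriv, ha, hb] with x h1 h2 h3 h4 hx
    rw [Set.uIcc_of_le hab] at hx
    have hx' : x ∈ Set.Ioo a b := ⟨lt_of_le_of_ne hx.1 h3.symm, lt_of_le_of_ne hx.2 h4⟩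
    simpa using (h1 hx').sub (h2 hx')
  obtain ⟨C, hC⟩ := hac.const_of_ae_hasDerivAt_zero h0
  have e1 := hC a (by simp)
  have e2 := hC b (by simp)
  simp only [Pi.sub_apply, intervalIntegral.integral_same, sub_zero] at e1 e2
  rw [e1, ← e2]; abel

theorem of_hasDerivAt [CompleteSpace E] (hab : a ≤ b)
    (h : ∀ x ∈ Set.Icc a b, HasDerivAt F (f x) x)
    (hf : ContinuousOn f (Set.Icc a b)) : ACD F f a b := by
  refine of_integral hab (hf.intervalIntegrable_of_Icc hab) fun x hx => ?_
  rw [intervalIntegral.integral_eq_sub_of_hasDerivAt]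
  · abel
  · intro y hy
    rw [Set.uIcc_of_le hx.1] at hy
    exact h y ⟨hy.1, hy.2.trans hx.2⟩
  · exact (hf.mono (Set.Icc_subset_Icc_right hx.2)).intervalIntegrable_of_Icc hx.1

theorem congr_deriv (h : ACD F f a b) (hfg : ∀ x ∈ Set.Icc a b, f x = g x) (hab : a ≤ b) :
    ACD F g a b := by
  refine ⟨h.ac, ?_, h.int.congr fun x hx => hfg x ?_⟩
  · filter_upwards [h.deriv] with x hx hxm
    rw [← hfg x (Set.Ioo_subset_Icc_self hxm)]
    exact hx hxm
  · rw [Set.uIoc_of_le hab] at hx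
    exact Set.Ioc_subset_Icc_self hx

theorem sub (hF : ACD F f a b) (hG : ACD G g a b) :
    ACD (fun x => F x - G x) (fun x => f x - g x) a b := by
  refine ⟨hF.ac.sub hG.ac, ?_, hF.int.sub hG.int⟩
  filter_upwards [hF.deriv, hG.deriv] with x h1 h2 hx
  exact (h1 hx).sub (h2 hx)

theorem add (hF : ACD F f a b) (hG : ACD G g a b) :
    ACD (fun x => F x + G x) (fun x => f x + g x) a b := by
  refine ⟨hF.ac.add hG.ac, ?_, hF.int.add hG.int⟩
  filter_upwards [hF.deriv, hG.deriv] with x h1 h2 hx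
  exact (h1 hx).add (h2 hx)

theorem mul {𝕜 : Type*} [RCLike 𝕜] {F f G g : ℝ → 𝕜} (hF : ACD F f a b)
    (hG : ACD G g a b) :
    ACD (fun x => F x * G x) (fun x => f x * G x + F x * g x) a b := by
  refine ⟨hF.ac.smul hG.ac, ?_, ?_⟩
  · filter_upwards [hF.deriv, hG.deriv] with x h1 h2 hx
    exact (h1 hx).mul (h2 hx)
  · exact (hF.int.mul_continuousOn hG.ac.continuousOn).add
      (hG.int.continuousOn_mul hF.ac.continuousOn)

theorem const_mul {𝕜 : Type*} [RCLike 𝕜] {F f : ℝ → 𝕜} (c : 𝕜) (hF : ACD F f a b) :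
    ACD (fun x => c * F x) (fun x => c * f x) a b := by
  refine ⟨hF.ac.const_smul c, ?_, hF.int.const_mul c⟩
  filter_upwards [hF.deriv] with x h1 hx
  exact (h1 hx).const_mul c

theorem clm_comp {E' : Type*} [NormedAddCommGroup E'] [NormedSpace ℝ E'] (L : E →L[ℝ] E')
    (hF : ACD F f a b) : ACD (fun x => L (F x)) (fun x => L (f x)) a b := by
  refine ⟨hF.ac.of_dist_le (K := ‖L‖) fun x _ y _ => ?_, ?_, ?_⟩
  · rw [dist_eq_norm, dist_eq_norm, ← map_sub]
    exact L.le_opNorm _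
  · filter_upwards [hF.deriv] with x h1 hx
    exact L.hasFDerivAt.comp_hasDerivAt x (h1 hx)
  · exact ⟨L.integrable_comp hF.int.1, L.integrable_comp hF.int.2⟩

theorem exp {F f : ℝ → ℝ} (hF : ACD F f a b) :
    ACD (fun x => Real.exp (F x)) (fun x => Real.exp (F x) * f x) a b := by
  obtain ⟨C, hC⟩ := hF.ac.exists_bound
  have hL : ∀ x y : ℝ, x ≤ C → y ≤ C → |Real.exp x - Real.exp y| ≤ Real.exp C * |x - y| := by
    intro x y hx hy
    have := (convex_Iic C).norm_image_sub_le_of_norm_deriv_le (f := Real.exp) (C := Real.exp C)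
      (fun z _ => Real.differentiableAt_exp) (fun z hz => by
        rw [Real.deriv_exp, Real.norm_eq_abs, Real.abs_exp]
        exact Real.exp_le_exp.2 hz) (show y ∈ Set.Iic C from hy) (show x ∈ Set.Iic C from hx)
    simpa [Real.norm_eq_abs] using this
  have hac : AbsolutelyContinuousOnInterval (fun x => Real.exp (F x)) a b := by
    refine hF.ac.of_dist_le (K := Real.exp C) fun x hx y hy => ?_
    exact hL _ _ ((le_abs_self _).trans (hC x hx)) ((le_abs_self _).trans (hC y hy))
  refine ⟨hac, ?_, hF.int.continuousOn_mul hac.continuousOn⟩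
  filter_upwards [hF.deriv] with x h1 hx
  exact (h1 hx).exp

end ACD

/-- Gronwall's inequality with an integrable kernel. -/
theorem le_mul_exp_of_le_integral {N κ : ℝ → ℝ} {b N₀ : ℝ}
    (hκ : IntervalIntegrable κ volume 0 b) (hκ0 : ∀ x, 0 ≤ κ x)
    (hN : ContinuousOn N (Set.Icc 0 b))
    (h : ∀ x ∈ Set.Icc 0 b, N x ≤ N₀ + ∫ t in (0:ℝ)..x, κ t * N t) :
    ∀ x ∈ Set.Icc 0 b, N x ≤ N₀ * Real.exp (∫ t in (0:ℝ)..x, κ t) := by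
  intro x hx
  have hb : 0 ≤ b := hx.1.trans hx.2
  have hint : IntervalIntegrable (fun t => κ t * N t) volume 0 b :=
    hκ.mul_continuousOn (by rwa [Set.uIcc_of_le hb])
  have hR : ACD (fun x => N₀ + ∫ t in (0:ℝ)..x, κ t * N t) (fun t => κ t * N t) 0 b :=
    ACD.of_integral hb hint (by simp)
  have hm : ACD (fun x => ∫ t in (0:ℝ)..x, κ t) κ 0 b := ACD.of_integral hb hκ (by simp)
  have hP := (ACD.mul hR (hm.const_mul (-1)).exp).mono le_rfl hx.1 hx.2
  have h1 := hP.integral_eq hx.1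
  have h2 : ∫ t in (0:ℝ)..x, (κ t * N t * Real.exp (-1 * ∫ s in (0:ℝ)..t, κ s) +
      (N₀ + ∫ s in (0:ℝ)..t, κ s * N s) *
        (Real.exp (-1 * ∫ s in (0:ℝ)..t, κ s) * (-1 * κ t))) ≤ 0 := by
    rw [← neg_nonneg, ← intervalIntegral.integral_neg]
    refine intervalIntegral.integral_nonneg hx.1 fun t ht => ?_
    have h3 := h t ⟨ht.1, ht.2.trans hx.2⟩
    have h4 := mul_nonneg (mul_nonneg (hκ0 t) (Real.exp_nonneg (-1 * ∫ s in (0:ℝ)..t, κ s)))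
      (sub_nonneg.2 h3)
    nlinarith
  rw [h1] at h2
  simp only [intervalIntegral.integral_same, mul_zero, Real.exp_zero, add_zero, mul_one] at h2
  have h5 := h x hx
  have h6 := Real.exp_pos (∫ s in (0:ℝ)..x, κ s)
  rw [neg_one_mul, Real.exp_neg] at h2
  have h7 : (N₀ + ∫ s in (0:ℝ)..x, κ s * N s) ≤ N₀ * Real.exp (∫ s in (0:ℝ)..x, κ s) := by
    rw [← div_eq_mul_inv, sub_nonpos, div_le_iff₀ h6] at h2
    exact h2
  linarith

/-- `y` (with derivative `yd`) is a real solution of `-y'' + q y = t y` on `[0, ω]`. -/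
structure RSol (q : ℝ → ℝ) (t : ℝ) (y yd : ℝ → ℝ) (ω : ℝ) : Prop where
  deriv : ∀ x, HasDerivAt y (yd x) x
  acd : ACD yd (fun x => (q x - t) * y x) 0 ω

namespace RSol

variable {q : ℝ → ℝ} {t ω : ℝ} {y yd y₁ yd₁ y₂ yd₂ : ℝ → ℝ}

theorem continuous (h : RSol q t y yd ω) : Continuous y :=
  continuous_iff_continuousAt.2 fun x => (h.deriv x).continuousAt

theorem acd_self (h : RSol q t y yd ω) (hω : 0 ≤ ω) : ACD y yd 0 ω :=
  ACD.of_hasDerivAt hω (fun x _ => h.deriv x) (h.acd.continuousOn hω)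

theorem combination (h₁ : RSol q t y₁ yd₁ ω) (h₂ : RSol q t y₂ yd₂ ω) (hω : 0 ≤ ω) (c d : ℝ) :
    RSol q t (fun x => c * y₁ x + d * y₂ x) (fun x => c * yd₁ x + d * yd₂ x) ω where
  deriv x := ((h₁.deriv x).const_mul c).add ((h₂.deriv x).const_mul d)
  acd := ((h₁.acd.const_mul c).add (h₂.acd.const_mul d)).congr_deriv (fun x _ => by ring) hω

theorem wronskian_eq (h₁ : RSol q t y₁ yd₁ ω) (h₂ : RSol q t y₂ yd₂ ω) {x : ℝ}
    (hx : x ∈ Set.Icc 0 ω) :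
    y₁ x * yd₂ x - yd₁ x * y₂ x = y₁ 0 * yd₂ 0 - yd₁ 0 * y₂ 0 := by
  have hω : 0 ≤ ω := hx.1.trans hx.2
  have h := ((((h₁.acd_self hω).mul h₂.acd).sub (h₁.acd.mul (h₂.acd_self hω))).mono le_rfl
    hx.1 hx.2).integral_eq hx.1
  have h0 : ∀ s, yd₁ s * yd₂ s + y₁ s * ((q s - t) * y₂ s) -
      ((q s - t) * y₁ s * y₂ s + yd₁ s * yd₂ s) = 0 := fun s => by ring
  simp only [h0, intervalIntegral.integral_zero] at h
  linarith

/-- A solution vanishing at `0` with positive slope is nonnegative to the right of `0` as soon as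
there is a positive solution. -/
theorem nonneg_of_pos (h₁ : RSol q t y₁ yd₁ ω) (h₂ : RSol q t y₂ yd₂ ω)
    (hpos : ∀ x ∈ Set.Icc 0 ω, 0 < y₁ x) (h0 : y₂ 0 = 0) (hd0 : yd₂ 0 = 1) :
    ∀ x ∈ Set.Icc 0 ω, 0 ≤ y₂ x := by
  intro x hx
  have hω : 0 ≤ ω := hx.1.trans hx.2
  have hm : MonotoneOn (fun x => y₂ x / y₁ x) (Set.Icc 0 ω) := by
    refine monotoneOn_of_hasDerivWithinAt_nonneg (convex_Icc 0 ω)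
      (f' := fun x => (yd₂ x * y₁ x - y₂ x * yd₁ x) / y₁ x ^ 2) ?_ ?_ ?_
    · exact h₂.continuous.continuousOn.div h₁.continuous.continuousOn fun x hx => (hpos x hx).ne'
    · intro s hs
      rw [interior_Icc] at hs
      exact ((h₂.deriv s).div (h₁.deriv s)
        (hpos s (Set.Ioo_subset_Icc_self hs)).ne').hasDerivWithinAt
    · intro s hs
      rw [interior_Icc] at hs
      have := h₁.wronskian_eq h₂ (Set.Ioo_subset_Icc_self hs)
      rw [h0, hd0] at this
      have h3 := hpos 0 ⟨le_rfl, hω⟩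
      apply div_nonneg _ (sq_nonneg _)
      nlinarith
  have := hm ⟨le_rfl, hω⟩ hx hx.1
  simp only [h0, zero_div] at this
  have h4 := mul_nonneg this (hpos x hx).le
  rwa [div_mul_cancel₀ _ (hpos x hx).ne'] at h4

/-- A nonnegative solution which is positive at the endpoints has no (double) zeros. -/
theorem pos_of_nonneg (h₁ : RSol q t y₁ yd₁ ω) (h₂ : RSol q t y₂ yd₂ ω)
    (hnn : ∀ x ∈ Set.Icc 0 ω, 0 ≤ y₁ x) (hy0 : 0 < y₁ 0) (hyω : 0 < y₁ ω)
    (h0 : y₂ 0 = 0) (hd0 : yd₂ 0 = 1) : ∀ x ∈ Set.Icc 0 ω, 0 < y₁ x := by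
  intro x hx
  refine lt_of_le_of_ne (hnn x hx) fun hx0 => ?_
  have hx' : x ∈ Set.Ioo 0 ω := by
    refine ⟨lt_of_le_of_ne hx.1 ?_, lt_of_le_of_ne hx.2 ?_⟩
    · rintro rfl; exact hy0.ne hx0
    · rintro rfl; exact hyω.ne hx0
  have hmin : IsLocalMin y₁ x := by
    filter_upwards [Ioo_mem_nhds hx'.1 hx'.2] with s hs
    rw [← hx0]
    exact hnn s (Set.Ioo_subset_Icc_self hs)
  have hd := hmin.hasDerivAt_eq_zero (h₁.deriv x)
  have := h₁.wronskian_eq h₂ hx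
  rw [← hx0, hd, h0, hd0] at this
  linarith

theorem energy_pos {Q : ℝ} (h : RSol q t y yd ω) (hω : 0 ≤ ω)
    (hq : IntervalIntegrable q volume 0 ω) (hQ : ∫ x in (0:ℝ)..ω, |q x| ≤ Q) (hQ0 : 0 < Q)
    (ht : t < -Q ^ 2) {a b x₀ c : ℝ} (ha : 0 ≤ a) (hab : a < b) (hb : b ≤ ω)
    (hx₀ : x₀ ∈ Set.Icc a b) (hz : y x₀ = 0) (hc : c ∈ Set.Icc a b) (hyc : y c ≠ 0) :
    y a * yd a < y b * yd b := by
  have hI := (((h.acd_self hω).mul h.acd).mono ha hab.le hb).integral_eq hab.le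
  have hsub : Set.Icc a b ⊆ Set.Icc 0 ω := Set.Icc_subset_Icc ha hb
  have hydc : ContinuousOn yd (Set.Icc a b) := (h.acd.continuousOn hω).mono hsub
  have hyc' : ContinuousOn y (Set.Icc a b) := h.continuous.continuousOn
  have hqab : IntervalIntegrable q volume a b := hq.mono_set (by
    rwa [Set.uIcc_of_le hab.le, Set.uIcc_of_le hω])
  have iA : IntervalIntegrable (fun x => yd x ^ 2) volume a b :=
    (hydc.pow 2).intervalIntegrable_of_Icc hab.le
  have iB : IntervalIntegrable (fun x => y x ^ 2) volume a b :=
    (hyc'.pow 2).intervalIntegrable_of_Icc hab.le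
  have iq : IntervalIntegrable (fun x => |q x| * y x ^ 2) volume a b :=
    hqab.abs.mul_continuousOn (by rw [Set.uIcc_of_le hab.le]; exact hyc'.pow 2)
  set A := ∫ x in a..b, yd x ^ 2 with hA
  set B := ∫ x in a..b, y x ^ 2 with hB
  have hBpos : 0 < B := by
    refine intervalIntegral.integral_pos hab (hyc'.pow 2) (fun s _ => sq_nonneg _) ⟨c, hc, ?_⟩
    positivity
  have hsup : ∀ x ∈ Set.Icc a b, Q * y x ^ 2 ≤ A + Q ^ 2 * B := by
    intro x hx
    have e1 : ∫ s in x₀..x, Q * (2 * y s * yd s) = Q * y x ^ 2 := by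
      have e2 : ∫ s in x₀..x, Q * (2 * y s * yd s) = Q * y x ^ 2 - Q * y x₀ ^ 2 := by
        refine intervalIntegral.integral_eq_sub_of_hasDerivAt (f := fun s => Q * y s ^ 2) ?_ ?_
        · intro s _
          simpa using ((h.deriv s).pow 2).const_mul Q
        · refine ContinuousOn.intervalIntegrable ?_
          have hsub2 : Set.uIcc x₀ x ⊆ Set.Icc a b := Set.uIcc_subset_Icc hx₀ hx
          exact continuousOn_const.mul ((continuousOn_const.mul (hyc'.mono hsub2)).mul
            (hydc.mono hsub2))
      rw [e2, hz]; ring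
    rw [← e1]
    have i3 : IntervalIntegrable (fun s => yd s ^ 2 + Q ^ 2 * y s ^ 2) volume a b :=
      iA.add (iB.const_mul _)
    calc ∫ s in x₀..x, Q * (2 * y s * yd s) ≤ |∫ s in x₀..x, Q * (2 * y s * yd s)| :=
          le_abs_self _
      _ ≤ |∫ s in x₀..x, (yd s ^ 2 + Q ^ 2 * y s ^ 2)| := by
          rw [← Real.norm_eq_abs]
          refine intervalIntegral.norm_integral_le_abs_of_norm_le ?_ ?_
          · refine ae_of_all _ fun s => ?_
            rw [Real.norm_eq_abs, abs_le]
            constructor <;> nlinarith [sq_nonneg (yd s + Q * y s), sq_nonneg (yd s - Q * y s)]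
          · exact i3.mono_set (by
              rw [Set.uIcc_of_le hab.le]; exact Set.uIcc_subset_Icc hx₀ hx)
      _ ≤ |∫ s in a..b, (yd s ^ 2 + Q ^ 2 * y s ^ 2)| := by
          refine intervalIntegral.abs_integral_mono_interval ?_ ?_ i3
          · rw [Set.uIoc_of_le hab.le]
            rcases le_total x₀ x with h1 | h1
            · rw [Set.uIoc_of_le h1]; exact Set.Ioc_subset_Ioc hx₀.1 hx.2
            · rw [Set.uIoc_of_ge h1]; exact Set.Ioc_subset_Ioc hx.1 hx₀.2
          · exact ae_of_all _ fun s => by positivity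
      _ = A + Q ^ 2 * B := by
          rw [intervalIntegral.integral_add iA (iB.const_mul _),
            intervalIntegral.integral_const_mul, abs_of_nonneg]
          have : 0 ≤ A := intervalIntegral.integral_nonneg hab.le fun s _ => sq_nonneg _
          positivity
  have hS : 0 ≤ A + Q ^ 2 * B := le_trans (by positivity) (hsup c hc)
  have hqy : ∫ x in a..b, |q x| * y x ^ 2 ≤ A + Q ^ 2 * B := by
    have h1 : ∫ x in a..b, |q x| * y x ^ 2 ≤ ∫ x in a..b, |q x| * ((A + Q ^ 2 * B) / Q) := by
      refine intervalIntegral.integral_mono_on hab.le iq (hqab.abs.mul_const _) fun x hx => ?_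
      gcongr
      rw [le_div_iff₀ hQ0, mul_comm]
      exact hsup x hx
    have h2 : ∫ x in a..b, |q x| ≤ Q := by
      refine le_trans ?_ hQ
      exact intervalIntegral.integral_mono_interval ha hab.le hb
        (ae_of_all _ fun s => abs_nonneg _) hq.abs
    rw [intervalIntegral.integral_mul_const] at h1
    calc _ ≤ _ := h1
      _ ≤ Q * ((A + Q ^ 2 * B) / Q) := by gcongr
      _ = _ := by field_simp
  have hlow : A + (-t) * B - (A + Q ^ 2 * B) ≤
      ∫ x in a..b, (yd x * yd x + y x * ((q x - t) * y x)) := by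
    calc A + (-t) * B - (A + Q ^ 2 * B) ≤ A + (-t) * B - ∫ x in a..b, |q x| * y x ^ 2 := by
          linarith
      _ = ∫ x in a..b, (yd x ^ 2 + (-t) * y x ^ 2 - |q x| * y x ^ 2) := by
          rw [intervalIntegral.integral_sub (iA.add (iB.const_mul _)) iq,
            intervalIntegral.integral_add iA (iB.const_mul _),
            intervalIntegral.integral_const_mul]
      _ ≤ _ := by
          refine intervalIntegral.integral_mono_on hab.le
            ((iA.add (iB.const_mul _)).sub iq) ?_ fun x hx => ?_
          · exact (((h.acd_self hω).mul h.acd).mono ha hab.le hb).int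
          · nlinarith [neg_abs_le (q x), sq_nonneg (y x),
              mul_le_mul_of_nonneg_right (neg_abs_le (q x)) (sq_nonneg (y x))]
  rw [hI] at hlow
  nlinarith [mul_pos (show 0 < -t - Q ^ 2 by linarith) hBpos]

end RSol

namespace RSol

variable {q : ℝ → ℝ} {t ω : ℝ} {y yd : ℝ → ℝ}

/-- Far below the potential, a Floquet solution has no zeros. -/
theorem floquet_ne_zero {Q ρ : ℝ} (h : RSol q t y yd ω) (hω : 0 < ω)
    (hq : IntervalIntegrable q volume 0 ω) (hQ : ∫ x in (0:ℝ)..ω, |q x| ≤ Q) (hQ0 : 0 < Q)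
    (ht : t < -Q ^ 2) (hρ : ρ ≠ 0) (hy0 : y 0 ≠ 0) (hy : y ω = ρ * y 0)
    (hyd : yd ω = ρ * yd 0) : ∀ x ∈ Set.Icc 0 ω, y x ≠ 0 := by
  intro x hx hz
  have hyω : y ω ≠ 0 := by rw [hy]; exact mul_ne_zero hρ hy0
  have hx0 : 0 < x := lt_of_le_of_ne hx.1 (by rintro rfl; exact hy0 hz)
  have hx1 : x < ω := lt_of_le_of_ne hx.2 (by rintro rfl; exact hyω hz)
  have h1 := h.energy_pos hω.le hq hQ hQ0 ht le_rfl hx0 hx.2 ⟨hx0.le, le_rfl⟩ hz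
    ⟨le_rfl, hx0.le⟩ hy0
  have h2 := h.energy_pos hω.le hq hQ hQ0 ht hx.1 hx1 le_rfl ⟨le_rfl, hx1.le⟩ hz
    ⟨hx1.le, le_rfl⟩ hyω
  rw [hz, zero_mul] at h1 h2
  rw [hy, hyd] at h2
  nlinarith [mul_nonneg (sq_nonneg ρ) (neg_nonneg.2 h1.le)]

/-- Far below the potential, the Dirichlet solution is positive at `ω`. -/
theorem dirichlet_pos {Q : ℝ} (h : RSol q t y yd ω) (hω : 0 < ω)
    (hq : IntervalIntegrable q volume 0 ω) (hQ : ∫ x in (0:ℝ)..ω, |q x| ≤ Q) (hQ0 : 0 < Q)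
    (ht : t < -Q ^ 2) (hy0 : y 0 = 0) (hyd0 : yd 0 = 1) : 0 < y ω := by
  have hnz : ∀ b ∈ Set.Ioc 0 ω, ∃ c ∈ Set.Icc 0 b, y c ≠ 0 := by
    intro b hb
    by_contra! hcon
    have h1 : y =ᶠ[𝓝[>] 0] fun _ => 0 := by
      filter_upwards [Ioo_mem_nhdsGT hb.1] with s hs
      exact hcon s (Set.Ioo_subset_Icc_self hs)
    have h2 := ((h.deriv 0).hasDerivWithinAt (s := Set.Ioi 0)).congr_of_eventuallyEq h1.symm
      hy0.symm
    have h3 := (hasDerivWithinAt_const (0:ℝ) (Set.Ioi 0) (0:ℝ))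
    have := (uniqueDiffWithinAt_Ioi (0:ℝ)).eq_deriv _ h2 h3
    rw [hyd0] at this
    exact one_ne_zero this
  have hprod : ∀ b ∈ Set.Ioc 0 ω, 0 < y b * yd b := by
    intro b hb
    obtain ⟨c, hc, hyc⟩ := hnz b hb
    have := h.energy_pos hω.le hq hQ hQ0 ht le_rfl hb.1 hb.2 ⟨le_rfl, hb.1.le⟩ hy0 hc hyc
    rwa [hy0, zero_mul] at this
  have hyd : 0 < yd ω := by
    by_contra! hcon
    obtain ⟨c, hc, hc0⟩ := intermediate_value_Icc' hω.le (h.acd.continuousOn hω.le)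
      (show (0:ℝ) ∈ Set.Icc (yd ω) (yd 0) from ⟨hcon, by rw [hyd0]; norm_num⟩)
    have hc1 : 0 < c := lt_of_le_of_ne hc.1 (by rintro rfl; rw [hyd0] at hc0; norm_num at hc0)
    have := hprod c ⟨hc1, hc.2⟩
    rw [hc0, mul_zero] at this
    exact lt_irrefl _ this
  exact pos_of_mul_pos_left (hprod ω ⟨hω, le_rfl⟩) hyd.le

end RSol

/-- `u` is a periodic solution of the Riccati equation `u' + u² = q - t` on `[0, ω]`. -/
structure Riccati (q : ℝ → ℝ) (t : ℝ) (u : ℝ → ℝ) (ω : ℝ) : Prop where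
  acd : ACD u (fun x => q x - t - u x ^ 2) 0 ω
  periodic : u ω = u 0

theorem RSol.exists_riccati {q : ℝ → ℝ} {t ω ρ : ℝ} {y yd : ℝ → ℝ} (h : RSol q t y yd ω)
    (hω : 0 < ω) (hpos : ∀ x ∈ Set.Icc 0 ω, 0 < y x) (hy : y ω = ρ * y 0)
    (hyd : yd ω = ρ * yd 0) :
    ∃ u, Riccati q t u ω ∧ ∫ x in (0:ℝ)..ω, u x = Real.log ρ := by
  have hydc := h.acd.continuousOn hω.le
  have hyc := h.continuous.continuousOn (s := Set.Icc 0 ω)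
  have hy0 := hpos 0 ⟨le_rfl, hω.le⟩
  have hyω := hpos ω ⟨hω.le, le_rfl⟩
  have hρ : ρ ≠ 0 := by rintro rfl; rw [hy] at hyω; simp at hyω
  have hinv : ACD (fun x => (y x)⁻¹) (fun x => -yd x / y x ^ 2) 0 ω :=
    ACD.of_hasDerivAt hω.le (fun x hx => (h.deriv x).inv (hpos x hx).ne')
      (hydc.neg.div (hyc.pow 2) fun x hx => (pow_pos (hpos x hx) 2).ne')
  refine ⟨fun x => yd x * (y x)⁻¹, ⟨?_, ?_⟩, ?_⟩
  · refine (h.acd.mul hinv).congr_deriv (fun x hx => ?_) hω.le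
    have := (hpos x hx).ne'
    field_simp
    ring
  · rw [hy, hyd]
    field_simp
  · have h1 : ∫ x in (0:ℝ)..ω, yd x * (y x)⁻¹ = Real.log (y ω) - Real.log (y 0) := by
      refine intervalIntegral.integral_eq_sub_of_hasDerivAt
        (f := fun x => Real.log (y x)) ?_ ?_
      · intro x hx
        rw [Set.uIcc_of_le hω.le] at hx
        exact (h.deriv x).log (hpos x hx).ne'
      · exact (hydc.mul (hyc.inv₀ fun x hx => (hpos x hx).ne')).intervalIntegrable_of_Icc hω.le
    rw [h1, hy, Real.log_mul hρ hy0.ne']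
    ring

namespace Riccati

variable {q : ℝ → ℝ} {t ω : ℝ} {u : ℝ → ℝ}

theorem continuousOn (h : Riccati q t u ω) (hω : 0 ≤ ω) : ContinuousOn u (Set.Icc 0 ω) :=
  h.acd.continuousOn hω

theorem integral_sq (h : Riccati q t u ω) (hω : 0 ≤ ω) (hq : IntervalIntegrable q volume 0 ω) :
    ∫ x in (0:ℝ)..ω, u x ^ 2 = (∫ x in (0:ℝ)..ω, q x) - ω * t := by
  have h1 := h.acd.integral_eq hω
  have iu : IntervalIntegrable (fun x => u x ^ 2) volume 0 ω :=
    ((h.continuousOn hω).pow 2).intervalIntegrable_of_Icc hω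
  rw [intervalIntegral.integral_sub (hq.sub (by simp)) iu,
    intervalIntegral.integral_sub hq (by simp), h.periodic] at h1
  simp at h1
  linarith

/-- An elementary upper bound for the mean of `u`. -/
theorem integral_le (h : Riccati q t u ω) (hω : 0 ≤ ω) (hq : IntervalIntegrable q volume 0 ω)
    {s : ℝ} (hs : 0 < s) :
    ∫ x in (0:ℝ)..ω, u x ≤ ((∫ x in (0:ℝ)..ω, q x) - ω * t + ω * s ^ 2) / (2 * s) := by
  have iu : IntervalIntegrable (fun x => u x ^ 2) volume 0 ω :=
    ((h.continuousOn hω).pow 2).intervalIntegrable_of_Icc hω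
  have iu1 : IntervalIntegrable u volume 0 ω :=
    (h.continuousOn hω).intervalIntegrable_of_Icc hω
  calc ∫ x in (0:ℝ)..ω, u x ≤ ∫ x in (0:ℝ)..ω, (u x ^ 2 + s ^ 2) / (2 * s) := by
        refine intervalIntegral.integral_mono_on hω iu1 ((iu.add (by simp)).div_const _) ?_
        intro x _
        rw [le_div_iff₀ (by positivity)]
        nlinarith [sq_nonneg (u x - s)]
    _ = _ := by
        rw [intervalIntegral.integral_div, intervalIntegral.integral_add iu (by simp),
          h.integral_sq hω hq]
        simp

theorem ae_eq_of_integral_le (h : Riccati q t u ω) (hω : 0 < ω)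
    (hq : IntervalIntegrable q volume 0 ω) (hle : ∫ x in (0:ℝ)..ω, q x ≤ ω * t) :
    ∀ᵐ x : ℝ, x ∈ Set.Ioo 0 ω → q x = t := by
  have h0 : ∀ x ∈ Set.Icc 0 ω, u x = 0 := by
    by_contra! hcon
    obtain ⟨c, hc, huc⟩ := hcon
    have := intervalIntegral.integral_pos hω ((h.continuousOn hω.le).pow 2)
      (fun s _ => sq_nonneg (u s)) ⟨c, hc, by simp only [Pi.pow_apply]; positivity⟩
    simp only [Pi.pow_apply] at this
    rw [h.integral_sq hω.le hq] at this
    linarith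
  filter_upwards [h.acd.deriv] with x hx hxm
  have h1 := hx hxm
  have h2 : u =ᶠ[𝓝 x] fun _ => 0 := by
    filter_upwards [Ioo_mem_nhds hxm.1 hxm.2] with s hs
    exact h0 s (Set.Ioo_subset_Icc_self hs)
  have h3 := (h1.congr_of_eventuallyEq h2.symm).unique (hasDerivAt_const x (0:ℝ))
  rw [h0 x (Set.Ioo_subset_Icc_self hxm)] at h3
  linarith

/-- The lower bound for the mean of a periodic Riccati solution at large negative energy
`t = -k²`. -/
theorem exists_le_integral (hω : 0 < ω) (hq : IntervalIntegrable q volume 0 ω)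
    (hq2 : IntervalIntegrable (fun x => q x ^ 2) volume 0 ω) :
    ∃ k₀ > 0, ∀ k ≥ k₀, ∀ u, Riccati q (-k ^ 2) u ω → 0 ≤ ∫ x in (0:ℝ)..ω, u x →
      2 * ω * k ^ 2 + (∫ x in (0:ℝ)..ω, q x) - (∫ x in (0:ℝ)..ω, q x ^ 2) / k ^ 2
        ≤ 2 * k * ∫ x in (0:ℝ)..ω, u x := by
  set S := ∫ x in (0:ℝ)..ω, q x ^ 2 with hS
  set q₁ := ∫ x in (0:ℝ)..ω, q x with hq₁
  set C := (∫ x in (0:ℝ)..ω, |q x|) + (ω + S) / 2 with hC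
  have hS0 : 0 ≤ S := intervalIntegral.integral_nonneg hω.le fun x _ => sq_nonneg _
  have hC0 : 0 ≤ C := by
    have : 0 ≤ ∫ x in (0:ℝ)..ω, |q x| :=
      intervalIntegral.integral_nonneg hω.le fun x _ => abs_nonneg _
    positivity
  refine ⟨C + |q₁| / ω + 1, by positivity, fun k hk u h hu => ?_⟩
  have hk1 : 1 ≤ k := by
    have : 0 ≤ |q₁| / ω := by positivity
    linarith
  have hk0 : 0 < k := by linarith
  have huc := h.continuousOn hω.le
  have iu1 : IntervalIntegrable u volume 0 ω := huc.intervalIntegrable_of_Icc hω.le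
  have iu2 : IntervalIntegrable (fun x => u x ^ 2) volume 0 ω :=
    (huc.pow 2).intervalIntegrable_of_Icc hω.le
  have iw : IntervalIntegrable (fun x => u x ^ 2 - k ^ 2) volume 0 ω := iu2.sub (by simp)
  have iX : IntervalIntegrable (fun x => (u x ^ 2 - k ^ 2) ^ 2) volume 0 ω :=
    (((huc.pow 2).sub continuousOn_const).pow 2).intervalIntegrable_of_Icc hω.le
  have iqw : IntervalIntegrable (fun x => q x * (u x ^ 2 - k ^ 2)) volume 0 ω :=
    hq.mul_continuousOn (by
      rw [Set.uIcc_of_le hω.le]; exact (huc.pow 2).sub continuousOn_const)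
  -- testing the equation against `u² - k²`
  have hX : ∫ x in (0:ℝ)..ω, (u x ^ 2 - k ^ 2) ^ 2 ≤ S := by
    have hcub := ((((h.acd.mul h.acd).mul h.acd).const_mul (1 / 3 : ℝ)).sub
      (h.acd.const_mul (k ^ 2))).integral_eq hω.le
    have e1 : ∫ x in (0:ℝ)..ω, (q x * (u x ^ 2 - k ^ 2) - (u x ^ 2 - k ^ 2) ^ 2) = 0 := by
      rw [h.periodic, sub_self] at hcub
      refine Eq.trans ?_ hcub
      refine intervalIntegral.integral_congr fun x _ => ?_
      ring
    rw [intervalIntegral.integral_sub iqw iX] at e1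
    have e2 : ∫ x in (0:ℝ)..ω, q x * (u x ^ 2 - k ^ 2) ≤
        ∫ x in (0:ℝ)..ω, (1 / 2) * (q x ^ 2 + (u x ^ 2 - k ^ 2) ^ 2) := by
      refine intervalIntegral.integral_mono_on hω.le iqw ((hq2.add iX).const_mul _) fun x _ => ?_
      nlinarith [sq_nonneg (q x - (u x ^ 2 - k ^ 2))]
    rw [intervalIntegral.integral_const_mul, intervalIntegral.integral_add hq2 iX] at e2
    linarith
  have hosc : ∀ a ∈ Set.Icc 0 ω, ∀ b ∈ Set.Icc 0 ω, a ≤ b → |u b - u a| ≤ C := by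
    intro a ha b hb hab
    rw [← (h.acd.mono ha.1 hab hb.2).integral_eq hab]
    have iB : IntervalIntegrable (fun x => |q x| + (1 + (u x ^ 2 - k ^ 2) ^ 2) / 2)
        volume 0 ω := hq.abs.add (((by simp : IntervalIntegrable (fun _ : ℝ => (1:ℝ))
          volume 0 ω).add iX).div_const 2)
    have hsub : Set.uIcc a b ⊆ Set.uIcc 0 ω := by
      rw [Set.uIcc_of_le hab, Set.uIcc_of_le hω.le]
      exact Set.Icc_subset_Icc ha.1 hb.2
    calc |∫ x in a..b, (q x - -k ^ 2 - u x ^ 2)|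
        ≤ ∫ x in a..b, (|q x| + (1 + (u x ^ 2 - k ^ 2) ^ 2) / 2) := by
          rw [← Real.norm_eq_abs]
          refine intervalIntegral.norm_integral_le_of_norm_le hab ?_ (iB.mono_set hsub)
          refine ae_of_all _ fun x _ => ?_
          rw [Real.norm_eq_abs, abs_le]
          constructor <;> nlinarith [neg_abs_le (q x), le_abs_self (q x),
            sq_nonneg (u x ^ 2 - k ^ 2 - 1), sq_nonneg (u x ^ 2 - k ^ 2 + 1)]
      _ ≤ ∫ x in (0:ℝ)..ω, (|q x| + (1 + (u x ^ 2 - k ^ 2) ^ 2) / 2) :=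
          intervalIntegral.integral_mono_interval ha.1 hab hb.2
            (ae_of_all _ fun x => by positivity) iB
      _ ≤ C := by
          rw [intervalIntegral.integral_add hq.abs (by
            exact (((by simp : IntervalIntegrable (fun _ : ℝ => (1:ℝ))
              volume 0 ω).add iX).div_const 2)), intervalIntegral.integral_div,
            intervalIntegral.integral_add (by simp) iX]
          simp only [intervalIntegral.integral_const, sub_zero, smul_eq_mul, mul_one]
          linarith
  have hosc' : ∀ a ∈ Set.Icc 0 ω, ∀ b ∈ Set.Icc 0 ω, |u b - u a| ≤ C := by
    intro a ha b hb
    rcases le_total a b with hab | hab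
    · exact hosc a ha b hb hab
    · rw [abs_sub_comm]; exact hosc b hb a ha hab
  have hnn : ∀ x ∈ Set.Icc 0 ω, 0 ≤ u x := by
    by_contra! hcon
    obtain ⟨x, hx, hux⟩ := hcon
    obtain ⟨z, hz, huz⟩ : ∃ z ∈ Set.Icc 0 ω, 0 ≤ u z := by
      by_contra! hneg
      have := intervalIntegral.integral_pos hω huc.neg
        (fun s hs => (neg_pos.2 (hneg s (Set.Ioc_subset_Icc_self hs))).le)
        ⟨x, hx, neg_pos.2 hux⟩
      simp only [Pi.neg_apply, intervalIntegral.integral_neg] at this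
      linarith
    have hbd : ∀ s ∈ Set.Icc 0 ω, u s ^ 2 ≤ C ^ 2 := by
      intro s hs
      have h1 := abs_le.1 (hosc' x hx s hs)
      have h2 := abs_le.1 (hosc' z hz s hs)
      exact sq_le_sq' (by linarith) (by linarith)
    have h3 : ∫ s in (0:ℝ)..ω, u s ^ 2 ≤ ∫ s in (0:ℝ)..ω, C ^ 2 :=
      intervalIntegral.integral_mono_on hω.le iu2 (by simp) hbd
    rw [h.integral_sq hω.le hq] at h3
    simp only [intervalIntegral.integral_const, sub_zero, smul_eq_mul] at h3
    rw [← hq₁] at h3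
    have h4 : ω * k ≥ ω * C + |q₁| + ω := by
      have := mul_le_mul_of_nonneg_left hk hω.le
      have e : ω * (C + |q₁| / ω + 1) = ω * C + |q₁| + ω := by field_simp
      linarith
    have h5 : ω * k ^ 2 ≥ (ω * C + |q₁| + ω) * k := by nlinarith
    have h6 : (ω * C + |q₁| + ω) * k ≥ ω * C * (C + 1) + |q₁| + ω := by
      have e1 : C + 1 ≤ k := by
        have : 0 ≤ |q₁| / ω := by positivity
        linarith
      have : ω * C * (C + 1) ≤ ω * C * k := by gcongr
      have : |q₁| * 1 ≤ |q₁| * k := by gcongr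
      have : ω * 1 ≤ ω * k := by gcongr
      nlinarith
    nlinarith [neg_abs_le q₁, mul_nonneg hω.le hC0]
  have hfin : ∫ x in (0:ℝ)..ω, u x ^ 2 ≤
      ∫ x in (0:ℝ)..ω, (2 * k * u x - k ^ 2 + (u x ^ 2 - k ^ 2) ^ 2 / k ^ 2) := by
    refine intervalIntegral.integral_mono_on hω.le iu2
      (((iu1.const_mul _).sub (by simp)).add (iX.div_const _)) fun x hx => ?_
    have h1 := hnn x hx
    have h2 : (u x - k) ^ 2 ≤ (u x ^ 2 - k ^ 2) ^ 2 / k ^ 2 := by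
      rw [le_div_iff₀ (by positivity)]
      have e : (u x ^ 2 - k ^ 2) ^ 2 = (u x - k) ^ 2 * (u x + k) ^ 2 := by ring
      rw [e]
      gcongr
      linarith
    nlinarith
  rw [intervalIntegral.integral_add ((iu1.const_mul _).sub (by simp)) (iX.div_const _),
    intervalIntegral.integral_sub (iu1.const_mul _) (by simp),
    intervalIntegral.integral_const_mul, intervalIntegral.integral_div,
    h.integral_sq hω.le hq] at hfin
  simp only [intervalIntegral.integral_const, sub_zero, smul_eq_mul] at hfin
  have h7 : (∫ x in (0:ℝ)..ω, (u x ^ 2 - k ^ 2) ^ 2) / k ^ 2 ≤ S / k ^ 2 := by gcongr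
  linarith

end Riccati

theorem norm_chebyshev_C_eval_le (x : ℂ) (n : ℕ) :
    ‖(Polynomial.Chebyshev.C ℂ n).eval x‖ ≤ 2 * (1 + ‖x‖) ^ n := by
  have key : ∀ n : ℕ, ‖(Polynomial.Chebyshev.C ℂ n).eval x‖ ≤ 2 * (1 + ‖x‖) ^ n ∧
      ‖(Polynomial.Chebyshev.C ℂ (n + 1 : ℕ)).eval x‖ ≤ 2 * (1 + ‖x‖) ^ (n + 1) := by
    intro n
    induction n with
    | zero =>
      have := norm_nonneg x
      constructor
      · simp
      · simp only [zero_add, Nat.cast_one, Polynomial.Chebyshev.C_one, Polynomial.eval_X, pow_one]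
        linarith
    | succ n ih =>
      refine ⟨ih.2, ?_⟩
      have e : ((n + 1 + 1 : ℕ) : ℤ) = (n : ℤ) + 2 := by push_cast; ring
      have e' : ((n + 1 : ℕ) : ℤ) = (n : ℤ) + 1 := by push_cast; ring
      rw [e, Polynomial.Chebyshev.C_add_two, ← e', Polynomial.eval_sub, Polynomial.eval_mul,
        Polynomial.eval_X]
      have hx := norm_nonneg x
      have hp : 0 ≤ (1 + ‖x‖) ^ n := by positivity
      calc _ ≤ ‖x * (Polynomial.Chebyshev.C ℂ (n + 1 : ℕ)).eval x‖ +
            ‖(Polynomial.Chebyshev.C ℂ n).eval x‖ := norm_sub_le _ _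
        _ ≤ ‖x‖ * (2 * (1 + ‖x‖) ^ (n + 1)) + 2 * (1 + ‖x‖) ^ n := by
          rw [norm_mul]
          gcongr
          exacts [ih.2, ih.1]
        _ ≤ 2 * (1 + ‖x‖) ^ (n + 1 + 1) := by
          have e1 : (1 + ‖x‖) ^ (n + 1) = (1 + ‖x‖) ^ n * (1 + ‖x‖) := by ring
          have e2 : (1 + ‖x‖) ^ (n + 1 + 1) = (1 + ‖x‖) ^ n * ((1 + ‖x‖) * (1 + ‖x‖)) := by ring
          rw [e1, e2]
          nlinarith [mul_nonneg hp hx, mul_nonneg (mul_nonneg hp hx) hx]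
  exact (key n).1

theorem abs_chebyshev_C_eval_le {x : ℝ} (hx : |x| ≤ 2) (n : ℕ) :
    |(Polynomial.Chebyshev.C ℝ n).eval x| ≤ 2 := by
  obtain ⟨h1, h2⟩ := abs_le.1 hx
  have e : x = 2 * Real.cos (Real.arccos (x / 2)) := by
    rw [Real.cos_arccos (by linarith) (by linarith)]; ring
  rw [e, Polynomial.Chebyshev.C_two_mul_real_cos, abs_mul, abs_two]
  have := Real.abs_cos_le_one ((n : ℤ) * Real.arccos (x / 2))
  linarith

/-- A Phragmén–Lindelöf bound: an entire function of order `1/2` and type `ω` which takes values in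
`[-2, 2]` on `[e₀, ∞)` is at most `2 cosh (ω √(e₀ - t))` at `t < e₀`. -/
theorem le_mul_of_abs_le_two {F : ℂ → ℂ} {D : ℝ → ℝ} {e₀ ω A B C : ℝ}
    (hF : Differentiable ℂ F) (hD : ∀ t : ℝ, F t = D t) (hω : 0 ≤ ω) (hA : 0 ≤ A) (hB : 0 ≤ B)
    (hb : ∀ t ≥ e₀, |D t| ≤ 2)
    (hgr : ∀ (z : ℂ) (K : ℝ), 1 ≤ K → ‖z‖ ≤ K ^ 2 → ‖F z‖ ≤ A * Real.exp (B * K))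
    (hup : ∀ᶠ s : ℝ in atTop, |D (e₀ - s ^ 2)| ≤ C * Real.exp (ω * s))
    {s L : ℝ} (hs : 0 ≤ s) (hL : D (e₀ - s ^ 2) = 2 * Real.cosh L) : L ≤ ω * s := by
  have hpow : ∀ n : ℕ, (Real.exp (L - ω * s)) ^ n ≤ 2 := by
    intro n
    set h : ℂ → ℂ := fun w => (Polynomial.Chebyshev.C ℂ n).eval (F (e₀ - w ^ 2)) *
      cexp (-(n * ω * w)) with hh
    have hFd : Differentiable ℂ fun w : ℂ => F (e₀ - w ^ 2) :=
      hF.comp (by fun_prop)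
    have hd : Differentiable ℂ h :=
      ((Polynomial.differentiable _).comp hFd).mul (by fun_prop)
    have hreal : ∀ x : ℝ, F (e₀ - (x : ℂ) ^ 2) = D (e₀ - x ^ 2) := by
      intro x; rw [← hD]; push_cast; rfl
    have hmap : ∀ x : ℝ, (Polynomial.Chebyshev.C ℂ n).eval (x : ℂ) =
        ((Polynomial.Chebyshev.C ℝ n).eval x : ℝ) := by
      intro x
      exact (Polynomial.Chebyshev.algebraMap_eval_C (R' := ℂ) x n).symm
    have hnexp : ∀ w : ℂ, ‖cexp (-(n * ω * w))‖ = Real.exp (-(n * ω * w.re)) := by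
      intro w
      rw [Complex.norm_exp]
      congr 1
      simp
    have hC : ∀ z : ℂ, 0 ≤ z.re → ‖h z‖ ≤ 2 := by
      intro z hz
      refine PhragmenLindelof.right_half_plane_of_bounded_on_real hd.diffContOnCl
        ⟨1, by norm_num, n * (B + ω), ?_⟩ ?_ ?_ hz
      · refine Asymptotics.IsBigO.of_bound
          (2 * (1 + A) ^ n * Real.exp (n * (B * (|e₀| + 1)))) (Eventually.of_forall fun w => ?_)
        have hz1 : ‖(e₀ : ℂ) - w ^ 2‖ ≤ (|e₀| + 1 + ‖w‖) ^ 2 := by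
          calc _ ≤ ‖(e₀ : ℂ)‖ + ‖w ^ 2‖ := norm_sub_le _ _
            _ = |e₀| + ‖w‖ ^ 2 := by simp
            _ ≤ _ := by nlinarith [abs_nonneg e₀, norm_nonneg w, sq_nonneg (|e₀|),
                mul_nonneg (abs_nonneg e₀) (norm_nonneg w)]
        have h1 := hgr _ _ (by linarith [abs_nonneg e₀, norm_nonneg w]) hz1
        have h2 := norm_chebyshev_C_eval_le (F (e₀ - w ^ 2)) n
        set K := |e₀| + 1 + ‖w‖ with hK
        have hK0 : 0 ≤ B * K := by positivity
        have h3 : 1 + ‖F (e₀ - w ^ 2)‖ ≤ (1 + A) * Real.exp (B * K) := by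
          have := Real.one_le_exp hK0
          nlinarith
        rw [Real.norm_eq_abs, Real.abs_exp, hh]
        simp only [norm_mul, hnexp]
        calc _ ≤ (2 * ((1 + A) * Real.exp (B * K)) ^ n) * Real.exp (n * ω * ‖w‖) := by
              gcongr
              · exact h2.trans (by gcongr)
              · have := (abs_le.1 (Complex.abs_re_le_norm w)).1
                have h5 : (n:ℝ) * ω * (-w.re) ≤ n * ω * ‖w‖ := by gcongr; linarith
                linarith
          _ = _ := by
              rw [mul_pow, ← Real.exp_nat_mul, Real.rpow_one]
              have : Real.exp (n * (B * K)) * Real.exp (n * ω * ‖w‖) =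
                  Real.exp (n * (B * (|e₀| + 1))) * Real.exp (n * (B + ω) * ‖w‖) := by
                rw [← Real.exp_add, ← Real.exp_add]
                congr 1
                rw [hK]; ring
              linear_combination (2 * (1 + A) ^ n) * this
      · refine ⟨2 * (1 + C) ^ n, ?_⟩
        rw [eventually_map]
        filter_upwards [hup, eventually_ge_atTop 0] with x hx hx0
        rw [hh]
        simp only [norm_mul, hnexp, hreal, ofReal_re]
        have h2 := norm_chebyshev_C_eval_le (D (e₀ - x ^ 2)) n
        have h3 : 1 + |D (e₀ - x ^ 2)| ≤ (1 + C) * Real.exp (ω * x) := by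
          have := Real.one_le_exp (mul_nonneg hω hx0)
          nlinarith
        rw [norm_real, Real.norm_eq_abs] at h2
        calc _ ≤ (2 * ((1 + C) * Real.exp (ω * x)) ^ n) * Real.exp (-(n * ω * x)) := by
              gcongr
              exact h2.trans (by gcongr)
          _ = 2 * (1 + C) ^ n * (Real.exp (n * (ω * x)) * Real.exp (-(n * ω * x))) := by
              rw [mul_pow, ← Real.exp_nat_mul]; ring
          _ = 2 * (1 + C) ^ n := by
              rw [← Real.exp_add]
              ring_nf
              simp
      · intro x
        have e1 : F (e₀ - ((x : ℂ) * I) ^ 2) = D (e₀ + x ^ 2) := by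
          rw [← hD]
          congr 1
          push_cast
          rw [mul_pow, I_sq]; ring
        rw [hh]
        simp only [norm_mul, hnexp, e1, hmap, norm_real, Real.norm_eq_abs]
        have h1 := abs_chebyshev_C_eval_le (hb (e₀ + x ^ 2) (by nlinarith [sq_nonneg x])) n
        simpa using h1
    have h1 := hC s (by simpa using hs)
    rw [hh] at h1
    simp only [norm_mul, hnexp, hreal, ofReal_re, hL, hmap,
      Polynomial.Chebyshev.C_two_mul_real_cosh, norm_real, Real.norm_eq_abs] at h1
    rw [abs_two, abs_of_pos (Real.cosh_pos _)] at h1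
    have h2 : Real.exp (n * L) ≤ 2 * Real.cosh ((n : ℤ) * L) := by
      rw [Real.cosh_eq]
      have := Real.exp_pos (-((n : ℤ) * L))
      push_cast at this ⊢
      linarith
    calc Real.exp (L - ω * s) ^ n = Real.exp (n * L) * Real.exp (-(n * ω * s)) := by
          rw [← Real.exp_nat_mul, ← Real.exp_add]; congr 1; ring
      _ ≤ 2 * Real.cosh ((n : ℤ) * L) * Real.exp (-(n * ω * s)) := by gcongr
      _ ≤ 2 := h1
  by_contra! hcon
  have h1 : 1 < Real.exp (L - ω * s) := by
    rw [Real.one_lt_exp_iff]; linarith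
  obtain ⟨n, hn⟩ := pow_unbounded_of_one_lt 2 h1
  exact absurd (hpow n) (not_le.2 hn)

/-- `ψ`, with derivative `ψd`, solves `-ψ'' + q ψ = z ψ` on `[0, ω]`. -/
structure CSol (q : ℝ → ℝ) (z : ℂ) (ψ ψd : ℝ → ℂ) (ω : ℝ) : Prop where
  deriv : ∀ x, HasDerivAt ψ (ψd x) x
  acd : ACD ψd (fun x => ((q x : ℂ) - z) * ψ x) 0 ω

namespace CSol

variable {q : ℝ → ℝ} {z w : ℂ} {ω : ℝ} {ψ ψd χ χd : ℝ → ℂ}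

theorem continuous (h : CSol q z ψ ψd ω) : Continuous ψ :=
  continuous_iff_continuousAt.2 fun x => (h.deriv x).continuousAt

theorem acd_self (h : CSol q z ψ ψd ω) (hω : 0 ≤ ω) : ACD ψ ψd 0 ω :=
  ACD.of_hasDerivAt hω (fun x _ => h.deriv x) (h.acd.continuousOn hω)

theorem of_isScalarSol (h : IsScalarSol q z ψ ψd) (hω : 0 ≤ ω)
    (hq : IntervalIntegrable q volume 0 ω) : CSol q z ψ ψd ω where
  deriv := h.1
  acd := by
    have hψ : Continuous ψ := continuous_iff_continuousAt.2 fun x => (h.1 x).continuousAt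
    have hq' : IntervalIntegrable (fun x => (q x : ℂ)) volume 0 ω := ⟨hq.1.ofReal, hq.2.ofReal⟩
    exact ACD.of_integral hω ((hq'.sub (by simp)).mul_continuousOn hψ.continuousOn)
      fun x _ => h.2 x

theorem conj (h : CSol q z ψ ψd ω) :
    CSol q (starRingEnd ℂ z) (fun x => starRingEnd ℂ (ψ x)) (fun x => starRingEnd ℂ (ψd x)) ω where
  deriv x := conjCLE.toContinuousLinearMap.hasFDerivAt.comp_hasDerivAt x (h.deriv x)
  acd := by
    have := h.acd.clm_comp conjCLE.toContinuousLinearMap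
    simpa using this

theorem re {t : ℝ} (h : CSol q t ψ ψd ω) : RSol q t (fun x => (ψ x).re) (fun x => (ψd x).re) ω where
  deriv x := reCLM.hasFDerivAt.comp_hasDerivAt x (h.deriv x)
  acd := by
    have := h.acd.clm_comp reCLM
    simpa [← ofReal_sub, re_ofReal_mul] using this

/-- Lagrange's identity. -/
theorem lagrange (h₁ : CSol q z ψ ψd ω) (h₂ : CSol q w χ χd ω) {x : ℝ} (hx : x ∈ Set.Icc 0 ω) :
    ψ x * χd x - ψd x * χ x =
      ψ 0 * χd 0 - ψd 0 * χ 0 + (z - w) * ∫ s in (0:ℝ)..x, ψ s * χ s := by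
  have hω : 0 ≤ ω := hx.1.trans hx.2
  have h := ((((h₁.acd_self hω).mul h₂.acd).sub (h₁.acd.mul (h₂.acd_self hω))).mono le_rfl
    hx.1 hx.2).integral_eq hx.1
  have h0 : ∀ s, ψd s * χd s + ψ s * (((q s : ℂ) - w) * χ s) -
      (((q s : ℂ) - z) * ψ s * χ s + ψd s * χd s) = (z - w) * (ψ s * χ s) := fun s => by ring
  simp only [h0, intervalIntegral.integral_const_mul] at h
  linear_combination -h

theorem norm_le_exp {K Q : ℝ} (h : CSol q z ψ ψd ω) (hq : IntervalIntegrable q volume 0 ω)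
    (hQ : ∫ x in (0:ℝ)..ω, |q x| ≤ Q) (hK : 1 ≤ K) (hz : ‖z‖ ≤ K ^ 2) {x : ℝ}
    (hx : x ∈ Set.Icc 0 ω) :
    K * ‖ψ x‖ + ‖ψd x‖ ≤ (K * ‖ψ 0‖ + ‖ψd 0‖) * Real.exp (K * ω + Q) := by
  have hω : 0 ≤ ω := hx.1.trans hx.2
  have hψd := h.acd.continuousOn hω
  have hψ := h.continuous.continuousOn (s := Set.Icc 0 ω)
  have hκ : IntervalIntegrable (fun x => K + |q x|) volume 0 ω :=
    IntervalIntegrable.add (by simp) hq.abs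
  have hN : ContinuousOn (fun x => K * ‖ψ x‖ + ‖ψd x‖) (Set.Icc 0 ω) :=
    (hψ.norm.const_mul _).add hψd.norm
  have hsub : ∀ y ∈ Set.Icc 0 ω, Set.uIcc 0 y ⊆ Set.uIcc 0 ω := fun y hy => by
    rw [Set.uIcc_of_le hy.1, Set.uIcc_of_le hω]; exact Set.Icc_subset_Icc le_rfl hy.2
  have hint := hκ.mul_continuousOn (g := fun x => K * ‖ψ x‖ + ‖ψd x‖)
    (by rwa [Set.uIcc_of_le hω])
  have hG := le_mul_exp_of_le_integral hκ (fun x => by positivity) hN (N₀ := K * ‖ψ 0‖ + ‖ψd 0‖) ?_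
    x hx
  · refine hG.trans ?_
    gcongr
    calc ∫ t in (0:ℝ)..x, (K + |q t|) ≤ ∫ t in (0:ℝ)..ω, (K + |q t|) := by
          refine intervalIntegral.integral_mono_interval le_rfl hx.1 hx.2 ?_ hκ
          exact Eventually.of_forall fun t => by simp only [Pi.zero_apply]; positivity
      _ = K * ω + ∫ t in (0:ℝ)..ω, |q t| := by
          rw [intervalIntegral.integral_add (by simp) hq.abs]
          simp [mul_comm]
      _ ≤ _ := by gcongr
  · intro y hy
    have e1 := ((h.acd_self hω).mono le_rfl hy.1 hy.2).integral_eq hy.1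
    have e2 := (h.acd.mono le_rfl hy.1 hy.2).integral_eq hy.1
    have b1 : ‖ψ y‖ ≤ ‖ψ 0‖ + ∫ s in (0:ℝ)..y, ‖ψd s‖ := by
      have : ψ y = ψ 0 + ∫ s in (0:ℝ)..y, ψd s := by rw [e1]; ring
      rw [this]
      exact (norm_add_le _ _).trans (by
        gcongr; exact intervalIntegral.norm_integral_le_integral_norm hy.1)
    have b2 : ‖ψd y‖ ≤ ‖ψd 0‖ + ∫ s in (0:ℝ)..y, ‖((q s : ℂ) - z) * ψ s‖ := by
      have : ψd y = ψd 0 + ∫ s in (0:ℝ)..y, ((q s : ℂ) - z) * ψ s := by rw [e2]; ring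
      rw [this]
      exact (norm_add_le _ _).trans (by
        gcongr; exact intervalIntegral.norm_integral_le_integral_norm hy.1)
    have i1 : IntervalIntegrable (fun s => ‖ψd s‖) volume 0 y :=
      (h.acd_self hω).int.norm.mono_set (hsub y hy)
    have i2 : IntervalIntegrable (fun s => ‖((q s : ℂ) - z) * ψ s‖) volume 0 y :=
      h.acd.int.norm.mono_set (hsub y hy)
    have b3 : K * (∫ s in (0:ℝ)..y, ‖ψd s‖) + ∫ s in (0:ℝ)..y, ‖((q s : ℂ) - z) * ψ s‖ ≤
        ∫ s in (0:ℝ)..y, (K + |q s|) * (K * ‖ψ s‖ + ‖ψd s‖) := by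
      rw [← intervalIntegral.integral_const_mul,
        ← intervalIntegral.integral_add (i1.const_mul K) i2]
      refine intervalIntegral.integral_mono_on hy.1 ((i1.const_mul K).add i2)
        (hint.mono_set (hsub y hy)) fun s _ => ?_
      rw [norm_mul]
      have h3 : ‖(q s : ℂ) - z‖ ≤ |q s| + K ^ 2 :=
        (norm_sub_le _ _).trans (by rw [norm_real, Real.norm_eq_abs]; gcongr)
      have h4 := mul_le_mul_of_nonneg_right h3 (norm_nonneg (ψ s))
      have h5 := mul_nonneg (mul_nonneg (abs_nonneg (q s)) (norm_nonneg (ψ s)))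
        (sub_nonneg.2 hK)
      have h6 := mul_nonneg (abs_nonneg (q s)) (norm_nonneg (ψd s))
      nlinarith
    have hK0 : 0 ≤ K := by linarith
    have := mul_le_mul_of_nonneg_left b1 hK0
    linarith

end CSol

/-- `θ`, `φ` is the fundamental system of `-ψ'' + q ψ = z ψ` on `[0, ω]` normalized at `0`. -/
structure IsFund (q : ℝ → ℝ) (z : ℂ) (θ θd φ φd : ℝ → ℂ) (ω : ℝ) : Prop where
  solθ : CSol q z θ θd ω
  solφ : CSol q z φ φd ω
  θ_zero : θ 0 = 1
  θd_zero : θd 0 = 0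
  φ_zero : φ 0 = 0
  φd_zero : φd 0 = 1

namespace IsFund

variable {q : ℝ → ℝ} {z w : ℂ} {ω : ℝ} {θ θd φ φd χ χd : ℝ → ℂ}

theorem wronskian (h : IsFund q z θ θd φ φd ω) {x : ℝ} (hx : x ∈ Set.Icc 0 ω) :
    θ x * φd x - θd x * φ x = 1 := by
  rw [h.solθ.lagrange h.solφ hx, h.θ_zero, h.θd_zero, h.φ_zero, h.φd_zero]
  simp

/-- Variation of constants in the spectral parameter. -/
theorem eq_add (h : IsFund q z θ θd φ φd ω) (hχ : CSol q w χ χd ω) {x : ℝ}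
    (hx : x ∈ Set.Icc 0 ω) :
    χ x = χ 0 * θ x + χd 0 * φ x + (z - w) * (φ x * (∫ s in (0:ℝ)..x, θ s * χ s) -
      θ x * ∫ s in (0:ℝ)..x, φ s * χ s) := by
  have h1 := h.solθ.lagrange hχ hx
  have h2 := h.solφ.lagrange hχ hx
  have h3 := h.wronskian hx
  rw [h.θ_zero, h.θd_zero] at h1
  rw [h.φ_zero, h.φd_zero] at h2
  linear_combination φ x * h1 - θ x * h2 - χ x * h3

theorem deriv_eq_add (h : IsFund q z θ θd φ φd ω) (hχ : CSol q w χ χd ω) {x : ℝ}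
    (hx : x ∈ Set.Icc 0 ω) :
    χd x = χ 0 * θd x + χd 0 * φd x + (z - w) * (φd x * (∫ s in (0:ℝ)..x, θ s * χ s) -
      θd x * ∫ s in (0:ℝ)..x, φ s * χ s) := by
  have h1 := h.solθ.lagrange hχ hx
  have h2 := h.solφ.lagrange hχ hx
  have h3 := h.wronskian hx
  rw [h.θ_zero, h.θd_zero] at h1
  rw [h.φ_zero, h.φd_zero] at h2
  linear_combination φd x * h1 - θd x * h2 - χd x * h3

end IsFund

section Family

variable {q : ℝ → ℝ} {ω : ℝ} {θ θd φ φd χ χd : ℂ → ℝ → ℂ} {c d : ℂ}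

/-- Solutions with fixed initial data are bounded locally uniformly in the spectral parameter. -/
theorem CSol.exists_bound (hq : IntervalIntegrable q volume 0 ω)
    (hχ : ∀ z, CSol q z (χ z) (χd z) ω) (hc : ∀ z, χ z 0 = c) (hd : ∀ z, χd z 0 = d) (R : ℝ) :
    ∃ M, 0 ≤ M ∧ ∀ z, ‖z‖ ≤ R → ∀ x ∈ Set.Icc 0 ω, ‖χ z x‖ ≤ M ∧ ‖χd z x‖ ≤ M := by
  set K := 1 + |R|
  have hK : 1 ≤ K := by simp [K]
  refine ⟨(K * ‖c‖ + ‖d‖) * Real.exp (K * ω + ∫ x in (0:ℝ)..ω, |q x|), by positivity,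
    fun z hz x hx => ?_⟩
  have hz' : ‖z‖ ≤ K ^ 2 := by
    have := le_abs_self R
    have := abs_nonneg R
    simp only [K]; nlinarith
  have h := (hχ z).norm_le_exp hq le_rfl hK hz' hx
  rw [hc, hd] at h
  have h1 := norm_nonneg (χ z x)
  have h2 := norm_nonneg (χd z x)
  constructor <;> nlinarith

/-- Solutions with fixed initial data are locally Lipschitz in the spectral parameter, uniformly on
`[0, ω]`. -/
theorem IsFund.exists_lipschitz (h : ∀ z, IsFund q z (θ z) (θd z) (φ z) (φd z) ω) (hω : 0 ≤ ω)
    (hq : IntervalIntegrable q volume 0 ω)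
    (hχ : ∀ z, CSol q z (χ z) (χd z) ω) (hc : ∀ z, χ z 0 = c) (hd : ∀ z, χd z 0 = d) (R : ℝ) :
    ∃ C, 0 ≤ C ∧ ∀ z w, ‖z‖ ≤ R → ‖w‖ ≤ R → ∀ x ∈ Set.Icc 0 ω,
      ‖χ w x - χ z x‖ ≤ C * ‖w - z‖ := by
  obtain ⟨M₁, hM₁, hb₁⟩ := CSol.exists_bound hq (fun z => (h z).solθ)
    (fun z => (h z).θ_zero) (fun z => (h z).θd_zero) R
  obtain ⟨M₂, hM₂, hb₂⟩ := CSol.exists_bound hq (fun z => (h z).solφ)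
    (fun z => (h z).φ_zero) (fun z => (h z).φd_zero) R
  obtain ⟨M, hM, hb⟩ := CSol.exists_bound hq hχ hc hd R
  refine ⟨M₂ * (M₁ * M * ω) + M₁ * (M₂ * M * ω), by positivity, fun z w hz hw x hx => ?_⟩
  have hsub : ∀ s ∈ Set.uIoc 0 x, s ∈ Set.Icc 0 ω := fun s hs => by
    rw [Set.uIoc_of_le hx.1] at hs
    exact ⟨hs.1.le, hs.2.trans hx.2⟩
  have i1 : ‖∫ s in (0:ℝ)..x, θ z s * χ w s‖ ≤ M₁ * M * ω := by
    refine (intervalIntegral.norm_integral_le_of_norm_le_const (C := M₁ * M)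
      fun s hs => ?_).trans ?_
    · rw [norm_mul]
      have := (hb₁ z hz s (hsub s hs)).1
      have := (hb w hw s (hsub s hs)).1
      gcongr
    · rw [sub_zero, abs_of_nonneg hx.1]
      have := hx.2
      gcongr
  have i2 : ‖∫ s in (0:ℝ)..x, φ z s * χ w s‖ ≤ M₂ * M * ω := by
    refine (intervalIntegral.norm_integral_le_of_norm_le_const (C := M₂ * M)
      fun s hs => ?_).trans ?_
    · rw [norm_mul]
      have := (hb₂ z hz s (hsub s hs)).1
      have := (hb w hw s (hsub s hs)).1
      gcongr
    · rw [sub_zero, abs_of_nonneg hx.1]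
      have := hx.2
      gcongr
  have e1 := (h z).eq_add (hχ w) hx
  have e2 := (h z).eq_add (hχ z) hx
  have e : χ w x - χ z x = (z - w) * (φ z x * (∫ s in (0:ℝ)..x, θ z s * χ w s) -
      θ z x * ∫ s in (0:ℝ)..x, φ z s * χ w s) := by
    rw [hc, hd] at e1 e2
    rw [e1, e2]; ring
  rw [e, norm_mul, norm_sub_rev, mul_comm]
  gcongr
  refine (norm_sub_le _ _).trans ?_
  rw [norm_mul, norm_mul]
  have := (hb₁ z hz x hx).1
  have := (hb₂ z hz x hx).1
  gcongr

theorem IsFund.continuousAt_integral (h : ∀ z, IsFund q z (θ z) (θd z) (φ z) (φd z) ω)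
    (hω : 0 ≤ ω) (hq : IntervalIntegrable q volume 0 ω)
    (hχ : ∀ z, CSol q z (χ z) (χd z) ω) (hc : ∀ z, χ z 0 = c) (hd : ∀ z, χd z 0 = d) {a : ℝ → ℂ}
    (ha : Continuous a) {x : ℝ} (hx : x ∈ Set.Icc 0 ω) (z : ℂ) :
    ContinuousAt (fun w => ∫ s in (0:ℝ)..x, a s * χ w s) z := by
  obtain ⟨M, hM, hb⟩ := CSol.exists_bound hq hχ hc hd (‖z‖ + 1)
  obtain ⟨C, hC, hl⟩ := IsFund.exists_lipschitz h hω hq hχ hc hd (‖z‖ + 1)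
  have hnear : ∀ᶠ w in 𝓝 z, ‖w‖ ≤ ‖z‖ + 1 := by
    have := continuous_norm.continuousAt (x := z)
    exact (this.eventually (gt_mem_nhds (lt_add_one ‖z‖))).mono fun w hw => hw.le
  have hsub : ∀ s ∈ Set.uIoc 0 x, s ∈ Set.Icc 0 ω := fun s hs => by
    rw [Set.uIoc_of_le hx.1] at hs
    exact ⟨hs.1.le, hs.2.trans hx.2⟩
  refine intervalIntegral.continuousAt_of_dominated_interval
    (bound := fun s => ‖a s‖ * M) ?_ ?_ ?_ ?_
  · exact Eventually.of_forall fun w => (ha.mul (hχ w).continuous).aestronglyMeasurable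
  · filter_upwards [hnear] with w hw
    refine Eventually.of_forall fun s hs => ?_
    rw [norm_mul]
    have := (hb w hw s (hsub s hs)).1
    gcongr
  · exact (ha.norm.mul continuous_const).intervalIntegrable _ _
  · refine Eventually.of_forall fun s hs => continuousAt_const.mul ?_
    rw [ContinuousAt, tendsto_iff_norm_sub_tendsto_zero]
    refine squeeze_zero' (g := fun w => C * ‖w - z‖)
      (Eventually.of_forall fun _ => norm_nonneg _) ?_ ?_
    · filter_upwards [hnear] with w hw
      exact hl z w (by linarith) hw s (hsub s hs)
    · have : ContinuousAt (fun w : ℂ => C * ‖w - z‖) z := by fun_prop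
      simpa [ContinuousAt] using this

theorem differentiableAt_of_eq_add_mul {f G : ℂ → ℂ} {z : ℂ}
    (h : ∀ w, f w = f z + (z - w) * G w) (hG : ContinuousAt G z) : DifferentiableAt ℂ f z := by
  have hd : HasDerivAt f (-G z) z := by
    rw [hasDerivAt_iff_tendsto_slope]
    refine (hG.neg.tendsto.mono_left nhdsWithin_le_nhds).congr' ?_
    filter_upwards [self_mem_nhdsWithin] with w hw
    have hw' : w - z ≠ 0 := sub_ne_zero.2 hw
    rw [slope_def_field, h w, eq_div_iff hw']
    simp only [Pi.neg_apply]
    ring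
  exact hd.differentiableAt

theorem IsFund.differentiable (h : ∀ z, IsFund q z (θ z) (θd z) (φ z) (φd z) ω) (hω : 0 ≤ ω)
    (hq : IntervalIntegrable q volume 0 ω)
    (hχ : ∀ z, CSol q z (χ z) (χd z) ω) (hc : ∀ z, χ z 0 = c) (hd : ∀ z, χd z 0 = d) {x : ℝ}
    (hx : x ∈ Set.Icc 0 ω) : Differentiable ℂ fun w => χ w x := by
  intro z
  refine differentiableAt_of_eq_add_mul (G := fun w => φ z x * (∫ s in (0:ℝ)..x, θ z s * χ w s) -
      θ z x * ∫ s in (0:ℝ)..x, φ z s * χ w s) (fun w => ?_) ?_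
  · have e1 := (h z).eq_add (hχ w) hx
    have e2 := (h z).eq_add (hχ z) hx
    rw [hc, hd] at e1 e2
    rw [e1, e2]; ring
  · exact (continuousAt_const.mul
      (IsFund.continuousAt_integral h hω hq hχ hc hd (h z).solθ.continuous hx z)).sub
      (continuousAt_const.mul
      (IsFund.continuousAt_integral h hω hq hχ hc hd (h z).solφ.continuous hx z))

theorem IsFund.differentiable_deriv (h : ∀ z, IsFund q z (θ z) (θd z) (φ z) (φd z) ω) (hω : 0 ≤ ω)
    (hq : IntervalIntegrable q volume 0 ω)
    (hχ : ∀ z, CSol q z (χ z) (χd z) ω) (hc : ∀ z, χ z 0 = c) (hd : ∀ z, χd z 0 = d) {x : ℝ}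
    (hx : x ∈ Set.Icc 0 ω) : Differentiable ℂ fun w => χd w x := by
  intro z
  refine differentiableAt_of_eq_add_mul (G := fun w => φd z x * (∫ s in (0:ℝ)..x, θ z s * χ w s) -
      θd z x * ∫ s in (0:ℝ)..x, φ z s * χ w s) (fun w => ?_) ?_
  · have e1 := (h z).deriv_eq_add (hχ w) hx
    have e2 := (h z).deriv_eq_add (hχ z) hx
    rw [hc, hd] at e1 e2
    rw [e1, e2]; ring
  · exact (continuousAt_const.mul
      (IsFund.continuousAt_integral h hω hq hχ hc hd (h z).solθ.continuous hx z)).sub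
      (continuousAt_const.mul
      (IsFund.continuousAt_integral h hω hq hχ hc hd (h z).solφ.continuous hx z))

/-- Joint continuity in the spectral parameter and the (clamped) space variable. -/
theorem IsFund.continuous_uncurry (h : ∀ z, IsFund q z (θ z) (θd z) (φ z) (φd z) ω) (hω : 0 ≤ ω)
    (hq : IntervalIntegrable q volume 0 ω)
    (hχ : ∀ z, CSol q z (χ z) (χd z) ω) (hc : ∀ z, χ z 0 = c) (hd : ∀ z, χd z 0 = d) :
    ContinuousOn (fun p : ℂ × ℝ => χ p.1 p.2) (Set.univ ×ˢ Set.Icc 0 ω) := by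
  rintro ⟨z, x⟩ ⟨-, hx⟩
  obtain ⟨C, hC, hl⟩ := IsFund.exists_lipschitz h hω hq hχ hc hd (‖z‖ + 1)
  have hnear : ∀ᶠ p : ℂ × ℝ in 𝓝 (z, x), ‖p.1‖ ≤ ‖z‖ + 1 := by
    have : ContinuousAt (fun p : ℂ × ℝ => ‖p.1‖) (z, x) := by fun_prop
    exact (this.eventually (gt_mem_nhds (lt_add_one ‖z‖))).mono fun w hw => hw.le
  have h1 : Tendsto (fun p : ℂ × ℝ => χ p.1 p.2 - χ z p.2)
      (𝓝[Set.univ ×ˢ Set.Icc 0 ω] (z, x)) (𝓝 0) := by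
    rw [tendsto_zero_iff_norm_tendsto_zero]
    refine squeeze_zero' (g := fun p : ℂ × ℝ => C * ‖p.1 - z‖)
      (Eventually.of_forall fun _ => norm_nonneg _) ?_ ?_
    · filter_upwards [nhdsWithin_le_nhds hnear, self_mem_nhdsWithin] with p hp hpm
      exact hl z p.1 (by linarith) hp p.2 hpm.2
    · have : ContinuousAt (fun p : ℂ × ℝ => C * ‖p.1 - z‖) (z, x) := by fun_prop
      have := this.tendsto.mono_left (nhdsWithin_le_nhds (s := Set.univ ×ˢ Set.Icc 0 ω))
      simpa using this
  have h2 : ContinuousAt (fun p : ℂ × ℝ => χ z p.2) (z, x) :=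
    ((hχ z).continuous.comp continuous_snd).continuousAt
  have := h1.add (h2.tendsto.mono_left (nhdsWithin_le_nhds (s := Set.univ ×ˢ Set.Icc 0 ω)))
  simpa [ContinuousWithinAt] using this

end Family

theorem IntegrableOn.of_sq {q : ℝ → ℝ} {s : Set ℝ} (hs : volume s ≠ ⊤)
    (hm : AEStronglyMeasurable q (volume.restrict s)) (h : IntegrableOn (fun x => q x ^ 2) s) :
    IntegrableOn q s := by
  have h1 : IntegrableOn (fun x => 1 + q x ^ 2) s := Integrable.add (integrableOn_const hs) h
  refine Integrable.mono' h1 hm (Eventually.of_forall fun x => ?_)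
  rw [Real.norm_eq_abs, ← sq_abs]
  nlinarith [sq_nonneg (|q x| - 1), abs_nonneg (q x)]

/-- Where `q` fails to be measurable, the integral in `IsScalarSol` takes the value `0`. -/
theorem IsScalarSol.deriv_eq_of_not_measurable {q : ℝ → ℝ} {z : ℂ} {ψ ψd : ℝ → ℂ} {b ω : ℝ}
    (h : IsScalarSol q z ψ ψd) (hb0 : 0 ≤ b)
    (hb : AEStronglyMeasurable q (volume.restrict (Set.Ioc 0 b)))
    (hnm : ∀ x ∈ Set.Ioc b ω, ¬ AEStronglyMeasurable q (volume.restrict (Set.Ioc 0 x)))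
    (hψ : ∀ᶠ x in 𝓝[>] b, ψ x ≠ 0) : ∀ x ∈ Set.Ioc b ω, ψd x = ψd 0 := by
  intro x hx
  rw [h.2 x, intervalIntegral.integral_undef, add_zero]
  intro hint
  obtain ⟨c, hc, hcψ⟩ := mem_nhdsGT_iff_exists_Ioo_subset.1 hψ
  rw [Set.mem_Ioi] at hc
  obtain ⟨y, hy1, hy2⟩ := exists_between (lt_min hc hx.1)
  have hyc : y < c := hy2.trans_le (min_le_left _ _)
  have hyx : y < x := hy2.trans_le (min_le_right _ _)
  refine hnm y ⟨hy1, hyx.le.trans hx.2⟩ ?_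
  have hψc : Continuous ψ := continuous_iff_continuousAt.2 fun x => (h.1 x).continuousAt
  have h1 : AEStronglyMeasurable (fun t => ((q t : ℂ) - z) * ψ t)
      (volume.restrict (Set.Ioc b y)) :=
    hint.1.aestronglyMeasurable.mono_set (Set.Ioc_subset_Ioc hb0 hyx.le)
  have h2 : AEMeasurable (fun t => (((q t : ℂ) - z) * ψ t / ψ t + z).re)
      (volume.restrict (Set.Ioc b y)) :=
    Complex.measurable_re.comp_aemeasurable
      ((h1.aemeasurable.div hψc.measurable.aemeasurable).add_const z)
  have h3 : AEStronglyMeasurable q (volume.restrict (Set.Ioc b y)) := by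
    refine h2.aestronglyMeasurable.congr ?_
    filter_upwards [ae_restrict_mem measurableSet_Ioc] with t ht
    have : ψ t ≠ 0 := hcψ ⟨ht.1, ht.2.trans_lt hyc⟩
    rw [mul_div_cancel_right₀ _ this]
    simp
  rw [← Set.Ioc_union_Ioc_eq_Ioc hb0 hy1.le]
  exact aestronglyMeasurable_union_iff.2 ⟨hb, h3⟩

theorem CSol.ne_zero_of_im_pos {q : ℝ → ℝ} {z : ℂ} {ψ ψd : ℝ → ℂ} {b : ℝ} (h : CSol q z ψ ψd b)
    (hz : 0 < z.im) (hb : 0 < b) (h0 : ψ 0 ≠ 0) (hd0 : ψd 0 = 0) : ψ b ≠ 0 ∧ ψd b ≠ 0 := by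
  have hL := h.lagrange h.conj ⟨hb.le, le_rfl⟩
  have hpos : 0 < ∫ s in (0:ℝ)..b, normSq (ψ s) := by
    refine intervalIntegral.integral_pos hb (continuous_normSq.comp h.continuous).continuousOn
      (fun s _ => normSq_nonneg _) ⟨0, ⟨le_rfl, hb.le⟩, normSq_pos.2 h0⟩
  simp only [mul_conj, hd0, map_zero, mul_zero, zero_mul, sub_zero, zero_add,
    intervalIntegral.integral_ofReal] at hL
  have hne : (z - starRingEnd ℂ z) * ((∫ s in (0:ℝ)..b, normSq (ψ s) : ℝ) : ℂ) ≠ 0 := by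
    refine mul_ne_zero ?_ (ofReal_ne_zero.2 hpos.ne')
    rw [sub_conj]
    simp [hz.ne']
  rw [← hL] at hne
  constructor <;> intro h' <;> simp [h'] at hne

/-- The hypotheses on the fundamental system force `q` to be integrable on a period, except when
`1` is always an eigenvalue of the monodromy matrix. -/
theorem intervalIntegrable_of_isScalarSol {q : ℝ → ℝ} {ω : ℝ} (hω : 0 < ω)
    (hqL2 : IntervalIntegrable (fun x => q x ^ 2) volume 0 ω) {θ θd φ φd : ℂ → ℝ → ℂ}
    (hθ : ∀ z, IsScalarSol q z (θ z) (θd z)) (hφ : ∀ z, IsScalarSol q z (φ z) (φd z))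
    (hθi : ∀ z, θ z 0 = 1) (hθdi : ∀ z, θd z 0 = 0)
    (hφdi : ∀ z, φd z 0 = 1) {t : ℂ}
    (ht : ¬ (θ t ω = 1 ∧ θd t ω = 0 ∧ φd t ω = 1)) : IntervalIntegrable q volume 0 ω := by
  have hint : ∀ x ∈ Set.Icc 0 ω, AEStronglyMeasurable q (volume.restrict (Set.Ioc 0 x)) →
      IntervalIntegrable q volume 0 x := by
    intro x hx hm
    rw [intervalIntegrable_iff_integrableOn_Ioc_of_le hx.1]
    exact IntegrableOn.of_sq (by simp) hm
      (hqL2.1.mono_set (Set.Ioc_subset_Ioc le_rfl hx.2))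
  set S := {x : ℝ | x ∈ Set.Icc 0 ω ∧ AEStronglyMeasurable q (volume.restrict (Set.Ioc 0 x))}
    with hS
  have hS0 : (0:ℝ) ∈ S := ⟨⟨le_rfl, hω.le⟩, by simp⟩
  have hSb : BddAbove S := ⟨ω, fun x hx => hx.1.2⟩
  obtain ⟨u, -, hu, huS⟩ := exists_seq_tendsto_sSup ⟨0, hS0⟩ hSb
  set b := sSup S with hbdef
  have hb0 : 0 ≤ b := le_csSup hSb hS0
  have hbω : b ≤ ω := csSup_le ⟨0, hS0⟩ fun x hx => hx.1.2
  have hbm : AEStronglyMeasurable q (volume.restrict (Set.Ioc 0 b)) := by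
    rw [← restrict_Ioo_eq_restrict_Ioc]
    have h1 : AEStronglyMeasurable q (volume.restrict (⋃ n, Set.Ioc 0 (u n))) :=
      aestronglyMeasurable_iUnion_iff.2 fun n => (huS n).2
    refine h1.mono_set fun x hx => ?_
    obtain ⟨n, hn⟩ := (hu.eventually (lt_mem_nhds hx.2)).exists
    exact Set.mem_iUnion.2 ⟨n, hx.1, hn.le⟩
  rcases hbω.eq_or_lt with hbω' | hbω'
  · exact hint ω ⟨hω.le, le_rfl⟩ (hbω' ▸ hbm)
  exfalso
  have hnm : ∀ x ∈ Set.Ioc b ω, ¬ AEStronglyMeasurable q (volume.restrict (Set.Ioc 0 x)) :=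
    fun x hx hm => absurd (le_csSup hSb ⟨⟨hb0.trans hx.1.le, hx.2⟩, hm⟩) (not_le.2 hx.1)
  have hcont : ∀ z, Continuous (θ z) := fun z =>
    continuous_iff_continuousAt.2 fun x => ((hθ z).1 x).continuousAt
  have hne : ∀ z, θ z b ≠ 0 → ∀ᶠ x in 𝓝[>] b, θ z x ≠ 0 := fun z hz =>
    nhdsWithin_le_nhds ((hcont z).continuousAt.eventually_ne hz)
  rcases hb0.eq_or_lt with hb0' | hb0'
  · have h1 := (hθ t).deriv_eq_of_not_measurable hb0 hbm hnm (hne t (by rw [← hb0', hθi]; simp))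
    have h2 := (hφ t).deriv_eq_of_not_measurable hb0 hbm hnm (by
      have := ((hφ t).1 0).eventually_ne (c := 0) (by rw [hφdi]; simp)
      rw [← hb0']
      exact this.filter_mono (nhdsWithin_mono _ fun x hx => (Set.mem_Ioi.1 hx).ne'))
    rw [← hb0'] at h1 h2
    have hωm : ω ∈ Set.Ioc 0 ω := ⟨hω, le_rfl⟩
    refine ht ⟨?_, by rw [h1 ω hωm, hθdi], by rw [h2 ω hωm, hφdi]⟩
    have h3 := constant_of_has_deriv_right_zero (f := θ t) (a := 0) (b := ω)
      (hcont t).continuousOn (fun x hx => by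
        have h4 : θd t x = 0 := by
          rcases hx.1.eq_or_lt with h | h
          · rw [← h, hθdi]
          · rw [h1 x ⟨h, hx.2.le⟩, hθdi]
        have := (hθ t).1 x
        rw [h4] at this
        exact this.hasDerivWithinAt) ω ⟨hω.le, le_rfl⟩
    rw [h3, hθi]
  · obtain ⟨h1, h2⟩ := (CSol.of_isScalarSol (hθ I) hb0 (hint b ⟨hb0, hbω⟩ hbm)).ne_zero_of_im_pos
      (by simp) hb0' (by rw [hθi]; simp) (hθdi I)
    have h3 := (hθ I).deriv_eq_of_not_measurable hb0 hbm hnm (hne I h1)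
    have h4 : HasDerivWithinAt (θ I) 0 (Set.Ici b) b := by
      refine hasDerivWithinAt_Ici_of_tendsto_deriv (s := Set.Ioo b ω)
        (fun x _ => ((hθ I).1 x).differentiableAt.differentiableWithinAt)
        (hcont I).continuousWithinAt (Ioo_mem_nhdsGT hbω') ?_
      refine tendsto_const_nhds.congr' ?_
      filter_upwards [Ioo_mem_nhdsGT hbω'] with x hx
      rw [((hθ I).1 x).deriv, h3 x ⟨hx.1, hx.2.le⟩, hθdi]
    exact h2 ((uniqueDiffWithinAt_Ici b).eq_deriv _ ((hθ I).1 b).hasDerivWithinAt h4)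

/-- `c`, `s` is the real fundamental system of `-y'' + q y = t y` on `[0, ω]` normalized at `0`. -/
structure IsRFund (q : ℝ → ℝ) (t : ℝ) (c cd s sd : ℝ → ℝ) (ω : ℝ) : Prop where
  solc : RSol q t c cd ω
  sols : RSol q t s sd ω
  c_zero : c 0 = 1
  cd_zero : cd 0 = 0
  s_zero : s 0 = 0
  sd_zero : sd 0 = 1

/-- The larger root of `ρ² - D ρ + 1`. -/
def floquetMultiplier (D : ℝ) : ℝ := (D + √(D ^ 2 - 4)) / 2

theorem continuous_floquetMultiplier : Continuous floquetMultiplier := by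
  unfold floquetMultiplier
  fun_prop

theorem floquetMultiplier_sq {D : ℝ} (hD : 2 ≤ |D|) :
    floquetMultiplier D ^ 2 - D * floquetMultiplier D + 1 = 0 := by
  have h : 0 ≤ D ^ 2 - 4 := by nlinarith [sq_abs D]
  have := Real.sq_sqrt h
  unfold floquetMultiplier
  linear_combination this / 4

theorem one_le_floquetMultiplier {D : ℝ} (hD : 2 ≤ D) : 1 ≤ floquetMultiplier D := by
  have := Real.sqrt_nonneg (D ^ 2 - 4)
  unfold floquetMultiplier
  linarith

namespace IsRFund

variable {q : ℝ → ℝ} {t ω : ℝ} {c cd s sd : ℝ → ℝ}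

theorem wronskian (h : IsRFund q t c cd s sd ω) (hω : 0 ≤ ω) :
    c ω * sd ω - cd ω * s ω = 1 := by
  rw [h.solc.wronskian_eq h.sols ⟨hω, le_rfl⟩, h.c_zero, h.cd_zero, h.s_zero, h.sd_zero]
  simp

theorem sol (h : IsRFund q t c cd s sd ω) (hω : 0 ≤ ω) (ρ : ℝ) :
    RSol q t (fun x => s ω * c x + (ρ - c ω) * s x)
      (fun x => s ω * cd x + (ρ - c ω) * sd x) ω :=
  h.solc.combination h.sols hω _ _

theorem floquet (h : IsRFund q t c cd s sd ω) {ρ : ℝ} :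
    s ω * c ω + (ρ - c ω) * s ω = ρ * (s ω * c 0 + (ρ - c ω) * s 0) := by
  rw [h.c_zero, h.s_zero]; ring

theorem floquet_deriv (h : IsRFund q t c cd s sd ω) (hω : 0 ≤ ω) {ρ : ℝ}
    (hρ : ρ ^ 2 - (c ω + sd ω) * ρ + 1 = 0) :
    s ω * cd ω + (ρ - c ω) * sd ω = ρ * (s ω * cd 0 + (ρ - c ω) * sd 0) := by
  rw [h.cd_zero, h.sd_zero]
  linear_combination -hρ - h.wronskian hω

/-- Far below the potential, the Floquet solution is positive. -/
theorem floquet_pos {Q ρ : ℝ} (h : IsRFund q t c cd s sd ω) (hω : 0 < ω)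
    (hq : IntervalIntegrable q volume 0 ω) (hQ : ∫ x in (0:ℝ)..ω, |q x| ≤ Q) (hQ0 : 0 < Q)
    (ht : t < -Q ^ 2) (hρ : ρ ^ 2 - (c ω + sd ω) * ρ + 1 = 0) :
    0 < ρ ∧ ∀ x ∈ Set.Icc 0 ω, 0 < s ω * c x + (ρ - c ω) * s x := by
  have hs := h.sols.dirichlet_pos hω hq hQ hQ0 ht h.s_zero h.sd_zero
  have hρ0 : ρ ≠ 0 := by rintro rfl; simp at hρ
  have h0 : s ω * c 0 + (ρ - c ω) * s 0 = s ω := by rw [h.c_zero, h.s_zero]; ring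
  have hne := (h.sol hω.le ρ).floquet_ne_zero hω hq hQ hQ0 ht hρ0 (by rw [h0]; exact hs.ne')
    h.floquet (h.floquet_deriv hω.le hρ)
  have hpos : ∀ x ∈ Set.Icc 0 ω, 0 < s ω * c x + (ρ - c ω) * s x := by
    intro x hx
    by_contra! hcon
    obtain ⟨y, hy, hy0⟩ := intermediate_value_Icc' hx.1
      ((h.sol hω.le ρ).continuous.continuousOn (s := Set.Icc 0 x))
      (show (0:ℝ) ∈ Set.Icc _ _ from ⟨hcon, by rw [h0]; exact hs.le⟩)
    exact hne y ⟨hy.1, hy.2.trans hx.2⟩ hy0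
  refine ⟨?_, hpos⟩
  have h1 := hpos ω ⟨hω.le, le_rfl⟩
  rw [h.floquet, h0] at h1
  exact pos_of_mul_pos_left h1 hs.le

theorem sin_pos_of_nonneg (h : IsRFund q t c cd s sd ω) (hω : 0 < ω)
    (hnn : ∀ x ∈ Set.Icc 0 ω, 0 ≤ s x) (hD : 0 ≤ c ω + sd ω) : 0 < s ω := by
  refine lt_of_le_of_ne (hnn ω ⟨hω.le, le_rfl⟩) fun h0 => ?_
  have hW := h.wronskian hω.le
  rw [← h0, mul_zero, sub_zero] at hW
  have h1 := (hasDerivWithinAt_iff_tendsto_slope' (Set.self_notMem_Iio (a := ω))).1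
    ((h.sols.deriv ω).hasDerivWithinAt (s := Set.Iio ω))
  have h2 : sd ω ≤ 0 := by
    refine le_of_tendsto h1 ?_
    filter_upwards [Ioo_mem_nhdsLT hω] with x hx
    rw [slope_def_field, ← h0, sub_zero]
    exact div_nonpos_of_nonneg_of_nonpos (hnn x (Set.Ioo_subset_Icc_self hx))
      (by linarith [hx.2])
  have h3 : 0 ≤ c ω := by linarith
  nlinarith

end IsRFund

section Family

variable {q : ℝ → ℝ} {ω e₀ : ℝ} {c cd s sd : ℝ → ℝ → ℝ}

/-- Below the spectrum the discriminant exceeds `2`. -/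
theorem two_lt_discriminant (h : ∀ t, IsRFund q t (c t) (cd t) (s t) (sd t) ω) (hω : 0 < ω)
    (hq : IntervalIntegrable q volume 0 ω)
    (hD : Continuous fun t => c t ω + sd t ω) (hlt : ∀ t < e₀, 2 < |c t ω + sd t ω|) :
    ∀ t < e₀, 2 < c t ω + sd t ω := by
  intro t ht
  set Q := (∫ x in (0:ℝ)..ω, |q x|) + 1 with hQ
  have hQ0 : 0 < Q := by
    have : 0 ≤ ∫ x in (0:ℝ)..ω, |q x| :=
      intervalIntegral.integral_nonneg hω.le fun x _ => abs_nonneg _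
    linarith
  obtain ⟨t₁, ht₁⟩ := exists_lt (min t (-Q ^ 2))
  have ht₁t : t₁ < t := ht₁.trans_le (min_le_left _ _)
  have hlt₁ := hlt t₁ (ht₁t.trans ht)
  have h1 : 0 < c t₁ ω + sd t₁ ω := by
    have hρ := floquetMultiplier_sq hlt₁.le
    have := ((h t₁).floquet_pos hω hq (by linarith) hQ0 (ht₁.trans_le (min_le_right _ _)) hρ).1
    by_contra! hcon
    nlinarith
  by_contra! hcon
  have hneg : c t ω + sd t ω ≤ 0 := by
    have := hlt t ht
    rcases lt_abs.1 this with h | h <;> linarith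
  obtain ⟨y, hy, hy0⟩ := intermediate_value_Icc' ht₁t.le (hD.continuousOn (s := Set.Icc t₁ t))
    (show (0:ℝ) ∈ Set.Icc _ _ from ⟨hneg, h1.le⟩)
  have := hlt y (hy.2.trans_lt ht)
  simp only at hy0
  rw [hy0] at this
  norm_num at this

/-- Up to the bottom of the spectrum there is a positive Floquet solution. -/
theorem floquet_pos_of_le (h : ∀ t, IsRFund q t (c t) (cd t) (s t) (sd t) ω) (hω : 0 < ω)
    (hq : IntervalIntegrable q volume 0 ω)
    (hc : ContinuousOn (fun p : ℝ × ℝ => c p.1 p.2) (Set.univ ×ˢ Set.Icc 0 ω))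
    (hs : ContinuousOn (fun p : ℝ × ℝ => s p.1 p.2) (Set.univ ×ˢ Set.Icc 0 ω))
    (hD : Continuous fun t => c t ω + sd t ω) (hge : ∀ t ≤ e₀, 2 ≤ c t ω + sd t ω) :
    ∀ t ≤ e₀, ∀ x ∈ Set.Icc 0 ω,
      0 < s t ω * c t x + (floquetMultiplier (c t ω + sd t ω) - c t ω) * s t x := by
  have hclamp : Continuous fun p : ℝ × ℝ => (p.1, max 0 (min ω p.2)) := by fun_prop
  have hmaps : ∀ p : ℝ × ℝ, (p.1, max 0 (min ω p.2)) ∈ (Set.univ : Set ℝ) ×ˢ Set.Icc 0 ω :=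
    fun p => ⟨trivial, le_max_left _ _, max_le hω.le (min_le_left _ _)⟩
  have hc' : Continuous fun p : ℝ × ℝ => c p.1 (max 0 (min ω p.2)) :=
    hc.comp_continuous hclamp hmaps
  have hs' : Continuous fun p : ℝ × ℝ => s p.1 (max 0 (min ω p.2)) :=
    hs.comp_continuous hclamp hmaps
  have hcl : ∀ x ∈ Set.Icc 0 ω, max 0 (min ω x) = x := fun x hx => by
    rw [min_eq_right hx.2, max_eq_right hx.1]
  have hslice : ∀ x ∈ Set.Icc 0 ω, Continuous (fun t => c t x) ∧ Continuous fun t => s t x := by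
    intro x hx
    have h1 : Continuous fun t : ℝ => (t, x) := by fun_prop
    have h2 := hc'.comp h1
    have h3 := hs'.comp h1
    simp only [Function.comp_def, hcl x hx] at h2 h3
    exact ⟨h2, h3⟩
  obtain ⟨hcω, hsω⟩ := hslice ω ⟨hω.le, le_rfl⟩
  have hρ : Continuous fun t => floquetMultiplier (c t ω + sd t ω) :=
    continuous_floquetMultiplier.comp hD
  set Ψ : ℝ → ℝ → ℝ := fun t x =>
    s t ω * c t x + (floquetMultiplier (c t ω + sd t ω) - c t ω) * s t x with hΨ
  have hΨ' : Continuous fun p : ℝ × ℝ => Ψ p.1 (max 0 (min ω p.2)) :=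
    ((hsω.comp continuous_fst).mul hc').add
      (((hρ.comp continuous_fst).sub (hcω.comp continuous_fst)).mul hs')
  have hΨs : ∀ x ∈ Set.Icc 0 ω, Continuous fun t => Ψ t x := fun x hx =>
    (hsω.mul (hslice x hx).1).add ((hρ.sub hcω).mul (hslice x hx).2)
  have hΨsol : ∀ t, RSol q t (Ψ t) _ ω := fun t => (h t).sol hω.le _
  set P : Set ℝ := {t | ∀ x ∈ Set.Icc 0 ω, 0 < Ψ t x} with hP
  have hopen : IsOpen P := by
    rw [isOpen_iff_eventually]
    intro t ht
    have := isCompact_Icc.eventually_forall_of_forall_eventually (x₀ := t) (K := Set.Icc 0 ω)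
      (P := fun t x => 0 < Ψ t (max 0 (min ω x))) fun x hx =>
        hΨ'.continuousAt.eventually (lt_mem_nhds (by simpa only [hcl x hx] using ht x hx))
    filter_upwards [this] with t' ht' x hx
    simpa only [hcl x hx] using ht' x hx
  have hne : (Set.Iic e₀ ∩ P).Nonempty := by
    set Q := (∫ x in (0:ℝ)..ω, |q x|) + 1 with hQ
    have hQ0 : 0 < Q := by
      have : 0 ≤ ∫ x in (0:ℝ)..ω, |q x| :=
        intervalIntegral.integral_nonneg hω.le fun x _ => abs_nonneg _
      linarith
    obtain ⟨t₁, ht₁⟩ := exists_lt (min e₀ (-Q ^ 2))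
    have ht₁e : t₁ ≤ e₀ := (ht₁.trans_le (min_le_left _ _)).le
    exact ⟨t₁, ht₁e, ((h t₁).floquet_pos hω hq (by linarith) hQ0 (ht₁.trans_le (min_le_right _ _))
      (floquetMultiplier_sq ((hge t₁ ht₁e).trans (le_abs_self _)))).2⟩
  refine fun t ht => isPreconnected_Iic.subset_of_closure_inter_subset hopen hne ?_ ht
  rintro T ⟨hT, hTe⟩
  have hTΨ : ∀ x ∈ Set.Icc 0 ω, 0 ≤ Ψ T x := fun x hx =>
    closure_minimal (fun t (ht : t ∈ P) => (ht x hx).le)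
      (isClosed_le continuous_const (hΨs x hx)) hT
  have hTs : ∀ x ∈ Set.Icc 0 ω, 0 ≤ s T x := fun x hx =>
    closure_minimal (fun t (ht : t ∈ P) =>
      (hΨsol t).nonneg_of_pos (h t).sols ht (h t).s_zero (h t).sd_zero x hx)
      (isClosed_le continuous_const (hslice x hx).2) hT
  have hsT := (h T).sin_pos_of_nonneg hω hTs (by linarith [hge T hTe])
  have h0 : Ψ T 0 = s T ω := by simp only [hΨ]; rw [(h T).c_zero, (h T).s_zero]; ring
  have hρ1 := one_le_floquetMultiplier (hge T hTe)
  refine (hΨsol T).pos_of_nonneg (h T).sols hTΨ (by rw [h0]; exact hsT) ?_ (h T).s_zero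
    (h T).sd_zero
  have : Ψ T ω = floquetMultiplier (c T ω + sd T ω) * Ψ T 0 := (h T).floquet
  rw [this, h0]
  positivity

/-- Up to the bottom of the spectrum, the Riccati equation has a periodic solution, whose integral
is the Floquet exponent. -/
theorem exists_riccati_of_le (h : ∀ t, IsRFund q t (c t) (cd t) (s t) (sd t) ω) (hω : 0 < ω)
    (hq : IntervalIntegrable q volume 0 ω)
    (hc : ContinuousOn (fun p : ℝ × ℝ => c p.1 p.2) (Set.univ ×ˢ Set.Icc 0 ω))
    (hs : ContinuousOn (fun p : ℝ × ℝ => s p.1 p.2) (Set.univ ×ˢ Set.Icc 0 ω))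
    (hD : Continuous fun t => c t ω + sd t ω) (hlt : ∀ t < e₀, 2 < |c t ω + sd t ω|) {t : ℝ}
    (ht : t ≤ e₀) :
    ∃ u, Riccati q t u ω ∧ 0 ≤ ∫ x in (0:ℝ)..ω, u x ∧
      c t ω + sd t ω = 2 * Real.cosh (∫ x in (0:ℝ)..ω, u x) := by
  have hgt := two_lt_discriminant h hω hq hD hlt
  have hge : ∀ t ≤ e₀, 2 ≤ c t ω + sd t ω := by
    intro t ht
    have : Set.Iic e₀ ⊆ {t | 2 ≤ c t ω + sd t ω} := by
      rw [← closure_Iio]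
      exact closure_minimal (fun t ht => (hgt t ht).le) (isClosed_le continuous_const hD)
    exact this ht
  have hρ := floquetMultiplier_sq ((hge t ht).trans (le_abs_self _))
  have hρ1 := one_le_floquetMultiplier (hge t ht)
  obtain ⟨u, hu, huint⟩ := ((h t).sol hω.le _).exists_riccati hω
    (floquet_pos_of_le h hω hq hc hs hD hge t ht) (h t).floquet ((h t).floquet_deriv hω.le hρ)
  refine ⟨u, hu, ?_, ?_⟩
  · rw [huint]; exact Real.log_nonneg hρ1
  · have hρ0 : 0 < floquetMultiplier (c t ω + sd t ω) := by linarith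
    rw [huint, Real.cosh_log hρ0]
    field_simp
    linear_combination -hρ

end Family

theorem mem_spectrum_fin_two_iff {a b c d ρ : ℂ} :
    ρ ∈ spectrum ℂ !![a, b; c, d] ↔ ρ ^ 2 - (a + d) * ρ + (a * d - b * c) = 0 := by
  rw [spectrum.mem_iff, Matrix.isUnit_iff_isUnit_det, isUnit_iff_ne_zero, not_not,
    Matrix.det_fin_two]
  simp only [Matrix.sub_apply, Matrix.algebraMap_matrix_apply]
  simp
  constructor <;> intro h <;> linear_combination h

/-- A unimodular `2 × 2` matrix with real trace `D` has an eigenvalue of modulus `1` if and only if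
`|D| ≤ 2`. -/
theorem exists_mem_spectrum_norm_eq_one_iff {a b c d : ℂ} {D : ℝ} (hdet : a * d - b * c = 1)
    (htr : a + d = D) :
    (∃ ρ ∈ spectrum ℂ !![a, b; c, d], ‖ρ‖ = 1) ↔ |D| ≤ 2 := by
  simp only [mem_spectrum_fin_two_iff, hdet, htr]
  constructor
  · rintro ⟨ρ, hρ, h1⟩
    have h2 : (D : ℂ) * ρ = ρ ^ 2 + 1 := by linear_combination -hρ
    calc |D| = ‖(D : ℂ) * ρ‖ := by rw [norm_mul, h1, norm_real, mul_one, Real.norm_eq_abs]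
      _ = ‖ρ ^ 2 + 1‖ := by rw [h2]
      _ ≤ ‖ρ ^ 2‖ + ‖(1 : ℂ)‖ := norm_add_le _ _
      _ = 2 := by rw [norm_pow, h1]; norm_num
  · intro hD
    have h0 : 0 ≤ 1 - D ^ 2 / 4 := by nlinarith [sq_abs D, abs_nonneg D]
    have h1 := Real.sq_sqrt h0
    refine ⟨(D / 2 : ℝ) + √(1 - D ^ 2 / 4) * I, ?_, ?_⟩
    · have h2 : ((√(1 - D ^ 2 / 4) : ℝ) : ℂ) ^ 2 = 1 - (D : ℂ) ^ 2 / 4 := by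
        rw [← ofReal_pow, h1]; push_cast; ring
      push_cast
      linear_combination (I ^ 2) * h2 + (1 - (D : ℂ) ^ 2 / 4) * I_sq
    · rw [norm_add_mul_I, h1]
      rw [Real.sqrt_eq_one]
      ring

/-- The mean of the potential is at most the bottom of the spectrum. -/
theorem integral_le_mul_of_forall_riccati {q D : ℝ → ℝ} {F : ℂ → ℂ} {ω e₀ A B : ℝ} (hω : 0 < ω)
    (hq : IntervalIntegrable q volume 0 ω)
    (hq2 : IntervalIntegrable (fun x => q x ^ 2) volume 0 ω)
    (hF : Differentiable ℂ F) (hD : ∀ t : ℝ, F t = D t) (hA : 0 ≤ A) (hB : 0 ≤ B)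
    (hb : ∀ t ≥ e₀, |D t| ≤ 2)
    (hgr : ∀ (z : ℂ) (K : ℝ), 1 ≤ K → ‖z‖ ≤ K ^ 2 → ‖F z‖ ≤ A * Real.exp (B * K))
    (hR : ∀ t ≤ e₀, ∃ u, Riccati q t u ω ∧ 0 ≤ ∫ x in (0:ℝ)..ω, u x ∧
      D t = 2 * Real.cosh (∫ x in (0:ℝ)..ω, u x)) :
    ∫ x in (0:ℝ)..ω, q x ≤ ω * e₀ := by
  set m := ∫ x in (0:ℝ)..ω, q x with hm
  have hup : ∀ᶠ s : ℝ in atTop,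
      |D (e₀ - s ^ 2)| ≤ (2 * Real.exp |m - ω * e₀|) * Real.exp (ω * s) := by
    filter_upwards [eventually_ge_atTop 1] with s hs
    obtain ⟨u, hu, hu0, huD⟩ := hR (e₀ - s ^ 2) (by nlinarith)
    set L := ∫ x in (0:ℝ)..ω, u x
    have hL : L ≤ |m - ω * e₀| + ω * s := by
      refine (hu.integral_le hω.le hq (by linarith : 0 < s)).trans ?_
      rw [← hm, div_le_iff₀ (by linarith)]
      have := le_abs_self (m - ω * e₀)
      nlinarith [mul_nonneg (abs_nonneg (m - ω * e₀)) (sub_nonneg.2 hs), abs_nonneg (m - ω * e₀)]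
    rw [huD, abs_of_nonneg (by have := Real.cosh_pos L; positivity), mul_assoc, ← Real.exp_add]
    gcongr
    rw [Real.cosh_eq]
    have h1 : Real.exp (-L) ≤ Real.exp L := Real.exp_le_exp.2 (by linarith)
    have h2 := Real.exp_le_exp.2 hL
    linarith
  obtain ⟨k₀, hk₀, hk⟩ := Riccati.exists_le_integral hω hq hq2
  set S := ∫ x in (0:ℝ)..ω, q x ^ 2
  have hev : ∀ᶠ k : ℝ in atTop, m ≤ ω * e₀ + S / k ^ 2 := by
    filter_upwards [eventually_ge_atTop k₀, eventually_ge_atTop (1 + |e₀|)] with k hk1 hk2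
    have he := neg_abs_le e₀
    have hk3 : |e₀| ≤ k ^ 2 := by nlinarith [abs_nonneg e₀]
    obtain ⟨u, hu, hu0, huD⟩ := hR (-k ^ 2) (by linarith)
    have hs := Real.sq_sqrt (show 0 ≤ k ^ 2 + e₀ by linarith)
    have h1 := le_mul_of_abs_le_two hF hD hω.le hA hB hb hgr hup
      (s := √(k ^ 2 + e₀)) (Real.sqrt_nonneg _) (by rw [hs, ← huD]; congr 1; ring)
    have h2 := hk k hk1 u hu hu0
    have hk0 : 0 < k := hk₀.trans_le hk1
    have h3 := mul_le_mul_of_nonneg_left h1 hk0.le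
    have h4 := mul_nonneg hω.le (sq_nonneg (k - √(k ^ 2 + e₀)))
    nlinarith
  have hlim : Tendsto (fun k : ℝ => ω * e₀ + S / k ^ 2) atTop (𝓝 (ω * e₀ + 0)) :=
    tendsto_const_nhds.add (tendsto_const_nhds.div_atTop (tendsto_pow_atTop two_ne_zero))
  rw [add_zero] at hlim
  exact ge_of_tendsto hlim hev

theorem ae_eq_const_of_periodic {q : ℝ → ℝ} {ω e : ℝ} (hω : 0 < ω) (hper : Function.Periodic q ω)
    (h : ∀ᵐ x : ℝ, x ∈ Set.Ioo 0 ω → q x = e) : ∀ᵐ x : ℝ, q x = e := by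
  have h0 : ∀ᵐ x : ℝ, x ∈ Set.Ico 0 ω → q x = e := by
    have : ∀ᵐ x : ℝ, x ≠ 0 := by simp [ae_iff]
    filter_upwards [h, this] with x hx hx0 hxm
    exact hx ⟨lt_of_le_of_ne hxm.1 hx0.symm, hxm.2⟩
  have h1 : ∀ᵐ x : ℝ, ∀ n : ℤ, x - n * ω ∈ Set.Ico 0 ω → q (x - n * ω) = e := by
    rw [ae_all_iff]
    intro n
    exact (measurePreserving_sub_right volume (n * ω)).quasiMeasurePreserving.ae h0
  filter_upwards [h1] with x hx
  obtain ⟨n, hn, -⟩ := existsUnique_sub_zsmul_mem_Ico hω x 0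
  rw [zsmul_eq_mul, zero_add] at hn
  rw [← hx n hn, hper.sub_int_mul_eq]

theorem IsFund.ofReal_re_eq {q : ℝ → ℝ} {t ω : ℝ} {θ θd φ φd χ χd : ℝ → ℂ}
    (h : IsFund q t θ θd φ φd ω) (hχ : CSol q t χ χd ω) {a b : ℝ} (h0 : χ 0 = a) (hd0 : χd 0 = b)
    {x : ℝ} (hx : x ∈ Set.Icc 0 ω) :
    ((χ x).re : ℂ) = χ x ∧ ((χd x).re : ℂ) = χd x := by
  have hc := hχ.conj
  rw [conj_ofReal] at hc
  rw [← conj_eq_iff_re, ← conj_eq_iff_re]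
  constructor
  · rw [h.eq_add hc hx, h.eq_add hχ hx]; simp [h0, hd0]
  · rw [h.deriv_eq_add hc hx, h.deriv_eq_add hχ hx]; simp [h0, hd0]

/-- **Borg's uniqueness theorem** (Theorem 4.1). Let `q ∈ L²_loc(ℝ)` be real-valued and
periodic with period `ω > 0`, and let `h = -d²/dx² + q` be the associated self-adjoint
Schrödinger operator in `L²(ℝ)`. Here `θ(z,·,x₀)`, `φ(z,·,x₀)` is the fundamental system of
`-ψ'' + qψ = zψ` normalized at `x₀`, and (by Floquet theory) the spectrum of `h` is the set
of `λ ∈ ℝ` for which the monodromy matrix `Φ(λ) = [[θ, φ],[θ', φ']](λ, ω, 0)` has an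
eigenvalue of modulus `1`.  If `σ(h) = [e₀,∞)` for some `e₀ ∈ ℝ`, then `q(x) = e₀` for
a.e. `x ∈ ℝ`. -/
theorem borg_theorem (q : ℝ → ℝ)
    (hqL2 : ∀ a b : ℝ, IntervalIntegrable (fun x => q x ^ 2) volume a b)
    (ω : ℝ) (hω : 0 < ω) (hper : ∀ x, q (x + ω) = q x)
    (θ θd φ φd : ℂ → ℝ → ℝ → ℂ)
    (hθ : ∀ z x₀, IsScalarSol q z (fun x => θ z x x₀) (fun x => θd z x x₀))
    (hφ : ∀ z x₀, IsScalarSol q z (fun x => φ z x x₀) (fun x => φd z x x₀))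
    (hθi : ∀ z x₀, θ z x₀ x₀ = 1) (hθdi : ∀ z x₀, θd z x₀ x₀ = 0)
    (hφi : ∀ z x₀, φ z x₀ x₀ = 0) (hφdi : ∀ z x₀, φd z x₀ x₀ = 1)
    (e₀ : ℝ)
    (hspec : {t : ℝ | ∃ ρ ∈ spectrum ℂ
        (!![θ (t:ℂ) ω 0, φ (t:ℂ) ω 0; θd (t:ℂ) ω 0, φd (t:ℂ) ω 0]), ‖ρ‖ = 1}
      = Set.Ici e₀) :
    ∀ᵐ x : ℝ, q x = e₀ := by
  have hq : IntervalIntegrable q volume 0 ω := by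
    refine intervalIntegrable_of_isScalarSol hω (hqL2 0 ω) (fun z => hθ z 0) (fun z => hφ z 0)
      (fun z => hθi z 0) (fun z => hθdi z 0) (fun z => hφdi z 0) (t := ((e₀ - 1 : ℝ) : ℂ)) ?_
    rintro ⟨h1, h2, h3⟩
    have h4 : e₀ - 1 ∈ Set.Ici e₀ := by
      rw [← hspec]
      refine ⟨1, mem_spectrum_fin_two_iff.2 ?_, by simp⟩
      rw [h1, h2, h3]; ring
    rw [Set.mem_Ici] at h4
    linarith
  have hfund : ∀ z, IsFund q z (fun x => θ z x 0) (fun x => θd z x 0) (fun x => φ z x 0)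
      (fun x => φd z x 0) ω := fun z =>
    ⟨.of_isScalarSol (hθ z 0) hω.le hq, .of_isScalarSol (hφ z 0) hω.le hq, hθi z 0, hθdi z 0,
      hφi z 0, hφdi z 0⟩
  have hsolθ := fun z => (hfund z).solθ
  have hsolφ := fun z => (hfund z).solφ
  have hωm : ω ∈ Set.Icc 0 ω := ⟨hω.le, le_rfl⟩
  have hrfund : ∀ t : ℝ, IsRFund q t (fun x => (θ t x 0).re) (fun x => (θd t x 0).re)
      (fun x => (φ t x 0).re) (fun x => (φd t x 0).re) ω := fun t =>
    ⟨(hsolθ t).re, (hsolφ t).re, by simp [hθi], by simp [hθdi], by simp [hφi], by simp [hφdi]⟩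
  set F : ℂ → ℂ := fun z => θ z ω 0 + φd z ω 0 with hF
  set D : ℝ → ℝ := fun t => (θ t ω 0).re + (φd t ω 0).re with hD
  have hFD : ∀ t : ℝ, F t = D t := by
    intro t
    have h1 := ((hfund t).ofReal_re_eq (hsolθ t) (a := 1) (b := 0) (by simp [hθi]) (by simp [hθdi])
      hωm).1
    have h2 := ((hfund t).ofReal_re_eq (hsolφ t) (a := 0) (b := 1) (by simp [hφi]) (by simp [hφdi])
      hωm).2
    rw [hF, hD, ofReal_add, h1, h2]
  have hFd : Differentiable ℂ F :=
    (IsFund.differentiable hfund hω.le hq hsolθ (fun z => hθi z 0) (fun z => hθdi z 0) hωm).add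
      (IsFund.differentiable_deriv hfund hω.le hq hsolφ (fun z => hφi z 0) (fun z => hφdi z 0) hωm)
  have hgr : ∀ (z : ℂ) (K : ℝ), 1 ≤ K → ‖z‖ ≤ K ^ 2 →
      ‖F z‖ ≤ (2 * Real.exp (∫ x in (0:ℝ)..ω, |q x|)) * Real.exp (ω * K) := by
    intro z K hK hz
    have h1 := (hsolθ z).norm_le_exp hq le_rfl hK hz hωm
    have h2 := (hsolφ z).norm_le_exp hq le_rfl hK hz hωm
    simp only [hθi, hθdi, hφi, hφdi, norm_one, norm_zero, mul_one, mul_zero, add_zero, zero_add,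
      one_mul] at h1 h2
    have h3 : ‖θ z ω 0‖ ≤ Real.exp (K * ω + ∫ x in (0:ℝ)..ω, |q x|) := by
      refine le_of_mul_le_mul_left ?_ (by linarith : 0 < K)
      linarith [norm_nonneg (θd z ω 0)]
    have h4 : 0 ≤ K * ‖φ z ω 0‖ := by positivity
    refine (norm_add_le _ _).trans ?_
    rw [mul_assoc, ← Real.exp_add]
    ring_nf at h2 h3 ⊢
    linarith
  have hDc : Continuous D := by
    have h1 : Continuous fun t : ℝ => (F t).re :=
      continuous_re.comp (hFd.continuous.comp continuous_ofReal)
    simpa only [hFD, ofReal_re] using h1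
  have hmem : ∀ t : ℝ, |D t| ≤ 2 ↔ e₀ ≤ t := by
    intro t
    change _ ↔ t ∈ Set.Ici e₀
    rw [← hspec]
    refine (exists_mem_spectrum_norm_eq_one_iff ?_ (hFD t)).symm
    have := (hfund t).wronskian hωm
    linear_combination this
  have hreal : Continuous fun p : ℝ × ℝ => ((p.1 : ℂ), p.2) := by fun_prop
  have hR : ∀ t ≤ e₀, ∃ u, Riccati q t u ω ∧ 0 ≤ ∫ x in (0:ℝ)..ω, u x ∧
      D t = 2 * Real.cosh (∫ x in (0:ℝ)..ω, u x) := fun t ht =>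
    exists_riccati_of_le hrfund hω hq
      (continuous_re.comp_continuousOn ((IsFund.continuous_uncurry hfund hω.le hq hsolθ
        (fun z => hθi z 0) (fun z => hθdi z 0)).comp hreal.continuousOn
        fun p hp => ⟨trivial, hp.2⟩))
      (continuous_re.comp_continuousOn ((IsFund.continuous_uncurry hfund hω.le hq hsolφ
        (fun z => hφi z 0) (fun z => hφdi z 0)).comp hreal.continuousOn
        fun p hp => ⟨trivial, hp.2⟩))
      hDc (fun t ht => lt_of_not_ge fun h => absurd ((hmem t).1 h) (not_le.2 ht)) ht
  have hmean := integral_le_mul_of_forall_riccati hω hq (hqL2 0 ω) hFd hFD (by positivity) hω.le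
    (fun t ht => (hmem t).2 ht) hgr hR
  obtain ⟨u, hu, -⟩ := hR e₀ le_rfl
  exact ae_eq_const_of_periodic hω hper (hu.ae_eq_of_integral_le hω hq hmean)

end
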